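/- arXiv:1501.00524 — 3 statements merged into one kernel-verified Lean document; each statement's English description precedes it below -/
import Mathlib

section
/- Let λ = (k,ℓ) ∈ ℤ² with k ≥ ℓ, and for integers x ≥ y let mult_{(x,y)}(N(λ)) denote the dimension of the space of vectors v ∈ N(λ) with Z·v = x·v, Z′·v = y·v and N₊·v = 0 (the multiplicity of the K-type of highest weight (x,y)). Then mult_{(x,y)}(N(λ)) = 0 whenever x < k, or y < ℓ, or x−y ≢ k−ℓ (mod 2). If x ≥ k, y ≥ ℓ and x−y ≡ k−ℓ (mod 2), then mult_{(x,y)}(N(λ)) = ⌊(min(x−k, y−ℓ)+2)/2⌋ if y ≤ k, and mult_{(x,y)}(N(λ)) = ⌊min(x−k, y−ℓ)/2⌋ − ⌊(y−k−1)/2⌋ if y > k. -/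
/- Prelude: lowest weight modules for sp(4,C) -/

set_option linter.unusedVariables false

noncomputable section

open Complex

abbrev M4C := Matrix (Fin 4) (Fin 4) ℂ

def J4 : M4C := !![0,0,1,0; 0,0,0,1; -1,0,0,0; 0,-1,0,0]

/-- The Lie algebra `sp₄(ℂ)` of matrices `g` with `ᵀg J + J g = 0`. -/
def sp4 : Set M4C := {g | g.transpose * J4 + J4 * g = 0}

def ZM : M4C := (-I) • !![0,0,1,0; 0,0,0,0; -1,0,0,0; 0,0,0,0]
def ZM' : M4C := (-I) • !![0,0,0,0; 0,0,0,1; 0,0,0,0; 0,-1,0,0]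
def NPlus : M4C := ((1:ℂ)/2) • !![0,1,0,-I; -1,0,-I,0; 0,I,0,1; I,0,-1,0]
def NMinus : M4C := ((1:ℂ)/2) • !![0,1,0,I; -1,0,I,0; 0,-I,0,1; -I,0,-1,0]
def XPlus : M4C := ((1:ℂ)/2) • !![1,0,I,0; 0,0,0,0; I,0,-1,0; 0,0,0,0]
def XMinus : M4C := ((1:ℂ)/2) • !![1,0,-I,0; 0,0,0,0; -I,0,-1,0; 0,0,0,0]
def P1Plus : M4C := ((1:ℂ)/2) • !![0,1,0,I; 1,0,I,0; 0,I,0,-1; I,0,-1,0]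
def P1Minus : M4C := ((1:ℂ)/2) • !![0,1,0,-I; 1,0,-I,0; 0,-I,0,-1; -I,0,-1,0]
def P0Plus : M4C := ((1:ℂ)/2) • !![0,0,0,0; 0,1,0,I; 0,0,0,0; 0,I,0,-1]
def P0Minus : M4C := ((1:ℂ)/2) • !![0,0,0,0; 0,1,0,-I; 0,0,0,0; 0,-I,0,-1]

/-- The standard basis of `sp₄(ℂ)`. -/
def sp4Gens : Set M4C :=
  {ZM, ZM', NPlus, NMinus, XPlus, XMinus, P1Plus, P1Minus, P0Plus, P0Minus}

variable {V : Type} [AddCommGroup V] [Module ℂ V]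

/-- `ρ` is a representation of `sp₄(ℂ)` on `V`: a linear assignment of endomorphisms
turning brackets of elements of `sp₄` into commutators. -/
def IsRep (ρ : M4C →ₗ[ℂ] Module.End ℂ V) : Prop :=
  ∀ A ∈ sp4, ∀ B ∈ sp4, ρ (A * B - B * A) = ρ A * ρ B - ρ B * ρ A

/-- `w` generates `V` as a `U(𝔤)`-module. -/
def Generates (ρ : M4C →ₗ[ℂ] Module.End ℂ V) (w : V) : Prop :=
  ∀ v : V, v ∈ Submodule.span ℂ
    {x : V | ∃ ops : List M4C, (∀ A ∈ ops, A ∈ sp4Gens) ∧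
      x = (ops.map (fun A => ρ A)).prod w}

/-- The PBW-type vector `X₊^α P₁₊^β P₀₊^γ N₋^δ · w` for `t = (α, β, γ, δ)`. -/
def pbwVec (ρ : M4C →ₗ[ℂ] Module.End ℂ V) (w : V) (t : ℕ × ℕ × ℕ × ℕ) : V :=
  ((ρ XPlus) ^ t.1 * (ρ P1Plus) ^ t.2.1 * (ρ P0Plus) ^ t.2.2.1 * (ρ NMinus) ^ t.2.2.2) w

/-- `(V, ρ, w)` is a realization of the parabolic Verma module `N(k, ℓ)` with canonical
generator `w`: `w` is a vector of weight `(k, ℓ)` annihilated by `N₊` and by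
`𝔭₋ = ⟨X₋, P₁₋, P₀₋⟩`, with `N₋^{k-ℓ+1} w = 0`, generating `V`, and the PBW vectors
`X₊^α P₁₊^β P₀₊^γ N₋^δ w` (`α,β,γ ≥ 0`, `0 ≤ δ ≤ k-ℓ`) form a `ℂ`-basis of `V`. -/
structure IsVerma (k l : ℤ) (ρ : M4C →ₗ[ℂ] Module.End ℂ V) (w : V) : Prop where
  rep : IsRep ρ
  le : l ≤ k
  ne : w ≠ 0
  wtZ : ρ ZM w = (k : ℂ) • w
  wtZ' : ρ ZM' w = (l : ℂ) • w
  annNPlus : ρ NPlus w = 0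
  annXMinus : ρ XMinus w = 0
  annP1Minus : ρ P1Minus w = 0
  annP0Minus : ρ P0Minus w = 0
  annNMinusPow : ((ρ NMinus) ^ ((k - l).toNat + 1)) w = 0
  gen : Generates ρ w
  indep : LinearIndependent ℂ
    (fun t : {t : ℕ × ℕ × ℕ × ℕ // (t.2.2.2 : ℤ) ≤ k - l} => pbwVec ρ w t.1)
  spans : ∀ v : V, v ∈ Submodule.span ℂ
    (Set.range (fun t : {t : ℕ × ℕ × ℕ × ℕ // (t.2.2.2 : ℤ) ≤ k - l} => pbwVec ρ w t.1))

/-- A `ℂ`-subspace invariant under the action of `sp₄(ℂ)`. -/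
def IsInvariantSub (ρ : M4C →ₗ[ℂ] Module.End ℂ V) (W : Submodule ℂ V) : Prop :=
  ∀ A ∈ sp4, ∀ v ∈ W, ρ A v ∈ W

/-- Irreducibility of a representation of `sp₄(ℂ)`. -/
def IsIrreducibleRep (ρ : M4C →ₗ[ℂ] Module.End ℂ V) : Prop :=
  (∃ v : V, v ≠ 0) ∧ ∀ W : Submodule ℂ V, IsInvariantSub ρ W → W = ⊥ ∨ W = ⊤

/-- `(V, ρ, w)` is a realization of the irreducible lowest weight module `L(k, ℓ)` (the
unique irreducible quotient of `N(k, ℓ)`), with lowest weight vector `w`. -/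
structure IsHWIrred (k l : ℤ) (ρ : M4C →ₗ[ℂ] Module.End ℂ V) (w : V) : Prop where
  rep : IsRep ρ
  le : l ≤ k
  ne : w ≠ 0
  wtZ : ρ ZM w = (k : ℂ) • w
  wtZ' : ρ ZM' w = (l : ℂ) • w
  annNPlus : ρ NPlus w = 0
  annXMinus : ρ XMinus w = 0
  annP1Minus : ρ P1Minus w = 0
  annP0Minus : ρ P0Minus w = 0
  annNMinusPow : ((ρ NMinus) ^ ((k - l).toNat + 1)) w = 0
  gen : Generates ρ w
  irred : IsIrreducibleRep ρ

/-- The operator `U = m(m-1) P₀₊ + (m-1) P₁₊ N₋ + X₊ N₋²` (with parameter `m`). -/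
def opU (ρ : M4C →ₗ[ℂ] Module.End ℂ V) (m : ℤ) : Module.End ℂ V :=
  ((m * (m - 1) : ℤ) : ℂ) • ρ P0Plus + ((m - 1 : ℤ) : ℂ) • (ρ P1Plus * ρ NMinus)
    + ρ XPlus * (ρ NMinus) ^ 2

/-- The operator `L = m(m-1) X₋ - (m-1) P₁₋ N₋ + P₀₋ N₋²` (with parameter `m`). -/
def opL (ρ : M4C →ₗ[ℂ] Module.End ℂ V) (m : ℤ) : Module.End ℂ V :=
  ((m * (m - 1) : ℤ) : ℂ) • ρ XMinus - ((m - 1 : ℤ) : ℂ) • (ρ P1Minus * ρ NMinus)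
    + ρ P0Minus * (ρ NMinus) ^ 2

/-- The operator `E₊ = (m+2) P₁₊ + 2 N₋ X₊` (with parameter `m`). -/
def opEp (ρ : M4C →ₗ[ℂ] Module.End ℂ V) (m : ℤ) : Module.End ℂ V :=
  ((m + 2 : ℤ) : ℂ) • ρ P1Plus + (2 : ℂ) • (ρ NMinus * ρ XPlus)

/-- The operator `E₋ = (m+2) P₁₋ - 2 N₋ P₀₋` (with parameter `m`). -/
def opEm (ρ : M4C →ₗ[ℂ] Module.End ℂ V) (m : ℤ) : Module.End ℂ V :=
  ((m + 2 : ℤ) : ℂ) • ρ P1Minus - (2 : ℂ) • (ρ NMinus * ρ P0Minus)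

/-- The operator `D₊ = P₁₊² - 4 X₊ P₀₊`. -/
def opDp (ρ : M4C →ₗ[ℂ] Module.End ℂ V) : Module.End ℂ V :=
  (ρ P1Plus) ^ 2 - (4 : ℂ) • (ρ XPlus * ρ P0Plus)

/-- The operator `D₋ = P₁₋² - 4 X₋ P₀₋`. -/
def opDm (ρ : M4C →ₗ[ℂ] Module.End ℂ V) : Module.End ℂ V :=
  (ρ P1Minus) ^ 2 - (4 : ℂ) • (ρ XMinus * ρ P0Minus)

/-- The Casimir element `Ω₂` acting through `ρ`. -/
def casimir (ρ : M4C →ₗ[ℂ] Module.End ℂ V) : Module.End ℂ V :=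
  ((1:ℂ)/2) • (ρ ZM * ρ ZM) + ((1:ℂ)/2) • (ρ ZM' * ρ ZM')
    - ((1:ℂ)/2) • (ρ NPlus * ρ NMinus + ρ NMinus * ρ NPlus)
    + (ρ XPlus * ρ XMinus + ρ XMinus * ρ XPlus)
    + ((1:ℂ)/2) • (ρ P1Plus * ρ P1Minus + ρ P1Minus * ρ P1Plus)
    + (ρ P0Plus * ρ P0Minus + ρ P0Minus * ρ P0Plus)

/-- The space of highest weight vectors of weight `(x, y)`: vectors `v` with
`Z v = x v`, `Z′ v = y v`, `N₊ v = 0`. -/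
def hwSpace (ρ : M4C →ₗ[ℂ] Module.End ℂ V) (x y : ℤ) : Submodule ℂ V :=
  Module.End.eigenspace (ρ ZM) (x : ℂ) ⊓ Module.End.eigenspace (ρ ZM') (y : ℂ)
    ⊓ LinearMap.ker (ρ NPlus)

/-- The sequence `w_i = U^i w`, starting from a vector of weight `(ℓ+m, ℓ)`, with the
parameter of `U` updated to match the weight of its argument at each step. -/
def wseq (ρ : M4C →ₗ[ℂ] Module.End ℂ V) (w : V) (m : ℕ) : ℕ → V
  | 0 => w
  | i + 1 => opU ρ ((m : ℤ) - 2 * i) (wseq ρ w m i)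

/-- The span of the highest weight vectors whose weight `(x, y)` satisfies
`x ≡ lm + r (mod 2)`. -/
def parSpace (ρ : M4C →ₗ[ℂ] Module.End ℂ V) (lm : ℤ) (r : ℤ) : Submodule ℂ V :=
  Submodule.span ℂ {v : V | ∃ x y : ℤ, ρ ZM v = (x : ℂ) • v ∧ ρ ZM' v = (y : ℂ) • v ∧
    ρ NPlus v = 0 ∧ (x - lm) % 2 = r}

/-- The global form of the operator `E₊`, agreeing with `E₊` (with parameter `m = x - y`)
on every vector of weight `(x, y)`. -/
def opEpGlobal (ρ : M4C →ₗ[ℂ] Module.End ℂ V) : Module.End ℂ V :=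
  ρ P1Plus * (ρ ZM - ρ ZM' + 2) + (2 : ℂ) • (ρ NMinus * ρ XPlus)

/-- The simultaneous eigenspace of `Z` and `Z′` of weight `(x, y)`. -/
def wtSpace (ρ : M4C →ₗ[ℂ] Module.End ℂ V) (x y : ℤ) : Submodule ℂ V :=
  Module.End.eigenspace (ρ ZM) (x : ℂ) ⊓ Module.End.eigenspace (ρ ZM') (y : ℂ)

lemma mem_wtSpace {ρ : M4C →ₗ[ℂ] Module.End ℂ V} {x y : ℤ} {v : V} :
    v ∈ wtSpace ρ x y ↔ ρ ZM v = (x : ℂ) • v ∧ ρ ZM' v = (y : ℂ) • v := by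
  simp [wtSpace]

lemma ZM_mem_sp4 : ZM ∈ sp4 := by
  ext i j; fin_cases i <;> fin_cases j <;> simp [ZM, J4, Matrix.mul_apply, Fin.sum_univ_four]

lemma ZM'_mem_sp4 : ZM' ∈ sp4 := by
  ext i j; fin_cases i <;> fin_cases j <;> simp [ZM', J4, Matrix.mul_apply, Fin.sum_univ_four]

lemma NPlus_mem_sp4 : NPlus ∈ sp4 := by
  ext i j; fin_cases i <;> fin_cases j <;> simp [NPlus, J4, Matrix.mul_apply, Fin.sum_univ_four]

lemma NMinus_mem_sp4 : NMinus ∈ sp4 := by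
  ext i j; fin_cases i <;> fin_cases j <;> simp [NMinus, J4, Matrix.mul_apply, Fin.sum_univ_four]

lemma XPlus_mem_sp4 : XPlus ∈ sp4 := by
  ext i j; fin_cases i <;> fin_cases j <;> simp [XPlus, J4, Matrix.mul_apply, Fin.sum_univ_four]

lemma P1Plus_mem_sp4 : P1Plus ∈ sp4 := by
  ext i j; fin_cases i <;> fin_cases j <;> simp [P1Plus, J4, Matrix.mul_apply, Fin.sum_univ_four]

lemma P0Plus_mem_sp4 : P0Plus ∈ sp4 := by
  ext i j; fin_cases i <;> fin_cases j <;> simp [P0Plus, J4, Matrix.mul_apply, Fin.sum_univ_four]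

lemma bracket_NPlus_NMinus : NPlus * NMinus - NMinus * NPlus = ZM' - ZM := by
  ext i j; fin_cases i <;> fin_cases j <;>
    simp [ZM, ZM', NPlus, NMinus] <;> grind [Complex.I_mul_I]

/-- `A ∈ sp₄` has weight `(a, b)` under the adjoint action of `Z` and `Z′`. -/
def IsRootVector (A : M4C) (a b : ℤ) : Prop :=
  A ∈ sp4 ∧ ZM * A - A * ZM = (a : ℂ) • A ∧ ZM' * A - A * ZM' = (b : ℂ) • A

lemma isRootVector_NPlus : IsRootVector NPlus 1 (-1) := by
  refine ⟨NPlus_mem_sp4, ?_, ?_⟩ <;> ext i j <;> fin_cases i <;> fin_cases j <;>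
    simp [ZM, ZM', NPlus] <;> grind [Complex.I_mul_I]

lemma isRootVector_NMinus : IsRootVector NMinus (-1) 1 := by
  refine ⟨NMinus_mem_sp4, ?_, ?_⟩ <;> ext i j <;> fin_cases i <;> fin_cases j <;>
    simp [ZM, ZM', NMinus] <;> grind [Complex.I_mul_I]

lemma isRootVector_XPlus : IsRootVector XPlus 2 0 := by
  refine ⟨XPlus_mem_sp4, ?_, ?_⟩ <;> ext i j <;> fin_cases i <;> fin_cases j <;>
    simp [ZM, ZM', XPlus] <;> grind [Complex.I_mul_I]

lemma isRootVector_P1Plus : IsRootVector P1Plus 1 1 := by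
  refine ⟨P1Plus_mem_sp4, ?_, ?_⟩ <;> ext i j <;> fin_cases i <;> fin_cases j <;>
    simp [ZM, ZM', P1Plus] <;> grind [Complex.I_mul_I]

lemma isRootVector_P0Plus : IsRootVector P0Plus 0 2 := by
  refine ⟨P0Plus_mem_sp4, ?_, ?_⟩ <;> ext i j <;> fin_cases i <;> fin_cases j <;>
    simp [ZM, ZM', P0Plus] <;> grind [Complex.I_mul_I]

section Representation

variable {ρ : M4C →ₗ[ℂ] Module.End ℂ V}

lemma IsRep.map_mem_wtSpace (hρ : IsRep ρ) {A : M4C} {a b : ℤ} (hA : IsRootVector A a b)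
    {x y : ℤ} {v : V} (hv : v ∈ wtSpace ρ x y) : ρ A v ∈ wtSpace ρ (x + a) (y + b) := by
  obtain ⟨h₁, h₂⟩ := mem_wtSpace.1 hv
  have e₁ := LinearMap.congr_fun (hρ ZM ZM_mem_sp4 A hA.1) v
  have e₂ := LinearMap.congr_fun (hρ ZM' ZM'_mem_sp4 A hA.1) v
  rw [hA.2.1] at e₁
  rw [hA.2.2] at e₂
  simp only [map_smul, LinearMap.smul_apply, LinearMap.sub_apply, Module.End.mul_apply,
    h₁, h₂] at e₁ e₂
  rw [eq_sub_iff_add_eq, ← add_smul] at e₁ e₂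
  rw [mem_wtSpace, ← e₁, ← e₂]
  push_cast
  exact ⟨by rw [add_comm], by rw [add_comm]⟩

lemma IsRep.pow_map_mem_wtSpace (hρ : IsRep ρ) {A : M4C} {a b : ℤ} (hA : IsRootVector A a b)
    {x y : ℤ} {v : V} (hv : v ∈ wtSpace ρ x y) (n : ℕ) :
    (ρ A ^ n) v ∈ wtSpace ρ (x + n * a) (y + n * b) := by
  induction n with
  | zero => simpa using hv
  | succ n ih =>
    rw [pow_succ', Module.End.mul_apply]
    convert hρ.map_mem_wtSpace hA ih using 1
    push_cast
    congr 1 <;> ring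

lemma IsRep.NPlus_NMinus_apply (hρ : IsRep ρ) {x y : ℤ} {v : V} (hv : v ∈ wtSpace ρ x y) :
    ρ NPlus (ρ NMinus v) = ρ NMinus (ρ NPlus v) - ((x - y : ℤ) : ℂ) • v := by
  obtain ⟨h₁, h₂⟩ := mem_wtSpace.1 hv
  have e := LinearMap.congr_fun (hρ NPlus NPlus_mem_sp4 NMinus NMinus_mem_sp4) v
  rw [bracket_NPlus_NMinus] at e
  simp only [map_sub, LinearMap.sub_apply, Module.End.mul_apply, h₁, h₂] at e
  push_cast
  rw [sub_smul, ← neg_sub ((y : ℂ) • v), e]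
  abel

lemma IsRep.NPlus_pow_NMinus_apply (hρ : IsRep ρ) (n : ℕ) {x y : ℤ} {v : V}
    (hv : v ∈ wtSpace ρ x y) :
    (ρ NPlus ^ (n + 1)) (ρ NMinus v) = ρ NMinus ((ρ NPlus ^ (n + 1)) v)
      - (((n + 1) * (x - y + n) : ℤ) : ℂ) • (ρ NPlus ^ n) v := by
  induction n generalizing x y v with
  | zero => simpa using hρ.NPlus_NMinus_apply hv
  | succ n ih =>
    have hs (u : V) : (ρ NPlus ^ (n + 1 + 1)) u = (ρ NPlus ^ (n + 1)) (ρ NPlus u) := by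
      rw [pow_succ, Module.End.mul_apply]
    have hs' : (ρ NPlus ^ n) (ρ NPlus v) = (ρ NPlus ^ (n + 1)) v := by
      rw [pow_succ, Module.End.mul_apply]
    rw [hs, hs, hρ.NPlus_NMinus_apply hv, map_sub, map_smul,
      ih (hρ.map_mem_wtSpace isRootVector_NPlus hv), hs', sub_sub, ← add_smul]
    congr 2
    push_cast
    ring

/-- A vector of positive `𝔰𝔩₂`-weight killed by a power of `N₊` is in the image of `N₊`. -/
lemma IsRep.exists_NPlus_eq (hρ : IsRep ρ) (n : ℕ) {x y : ℤ} (hxy : y < x) {v : V}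
    (hv : v ∈ wtSpace ρ x y) (hn : (ρ NPlus ^ n) v = 0) :
    ∃ u ∈ wtSpace ρ (x - 1) (y + 1), ρ NPlus u = v := by
  induction n generalizing v with
  | zero => exact ⟨0, zero_mem _, by simpa using hn.symm⟩
  | succ n ih =>
    set c : ℂ := (((n + 1) * (x - y + n) : ℤ) : ℂ) with hc
    have hc0 : c ≠ 0 := by
      rw [hc, Int.cast_ne_zero]
      have : 0 < ((n : ℤ) + 1) * (x - y + n) := by
        apply mul_pos <;> omega
      exact this.ne'
    have hf : ρ NMinus v ∈ wtSpace ρ (x - 1) (y + 1) :=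
      hρ.map_mem_wtSpace isRootVector_NMinus hv
    have hef : ρ NPlus (ρ NMinus v) ∈ wtSpace ρ x y := by
      simpa using hρ.map_mem_wtSpace isRootVector_NPlus hf
    obtain ⟨u, hu, hu'⟩ := ih (v := ρ NPlus (ρ NMinus v) + c • v)
      (add_mem hef (Submodule.smul_mem _ _ hv)) (by
        rw [map_add, map_smul, ← Module.End.mul_apply, ← pow_succ,
          hρ.NPlus_pow_NMinus_apply n hv, hn, map_zero, zero_sub, neg_add_cancel])
    refine ⟨c⁻¹ • (u - ρ NMinus v), Submodule.smul_mem _ _ (sub_mem hu hf), ?_⟩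
    rw [map_smul, map_sub, hu', add_sub_cancel_left, inv_smul_smul₀ hc0]

end Representation

/-- A joint eigenspace of two operators diagonal in the basis `b` is spanned by the basis vectors
it contains. -/
lemma Module.Basis.eigenspace_inf_eigenspace {ι : Type*} (b : Module.Basis ι ℂ V)
    (f g : Module.End ℂ V) (p q : ι → ℂ) (hf : ∀ i, f (b i) = p i • b i)
    (hg : ∀ i, g (b i) = q i • b i) (s t : ℂ) :
    Module.End.eigenspace f s ⊓ Module.End.eigenspace g t =
      Submodule.span ℂ (b '' {i | p i = s ∧ q i = t}) := by
  have key (f : Module.End ℂ V) (p : ι → ℂ) (hf : ∀ i, f (b i) = p i • b i) (v : V) (i : ι) :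
      b.repr (f v) i = p i * b.repr v i := by
    have : (Finsupp.lapply i ∘ₗ b.repr.toLinearMap) ∘ₗ f =
        p i • (Finsupp.lapply i ∘ₗ b.repr.toLinearMap) := by
      refine b.ext fun j => ?_
      by_cases hij : j = i <;> simp [hf, hij]
    simpa using LinearMap.congr_fun this v
  apply le_antisymm
  · rintro v ⟨hv, hv'⟩
    rw [SetLike.mem_coe, Module.End.mem_eigenspace_iff] at hv hv'
    rw [Module.Basis.mem_span_image]
    intro i hi
    have h0 : b.repr v i ≠ 0 := by simpa using hi
    have e₁ := key f p hf v i
    have e₂ := key g q hg v i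
    rw [hv, map_smul, Finsupp.smul_apply, smul_eq_mul] at e₁
    rw [hv', map_smul, Finsupp.smul_apply, smul_eq_mul] at e₂
    exact ⟨(mul_right_cancel₀ h0 e₁).symm, (mul_right_cancel₀ h0 e₂).symm⟩
  · rw [Submodule.span_le]
    rintro _ ⟨i, ⟨rfl, rfl⟩, rfl⟩
    exact ⟨Module.End.mem_eigenspace_iff.2 (hf i), Module.End.mem_eigenspace_iff.2 (hg i)⟩

/-- The exponents `(α, β, γ)` with `X₊^α P₁₊^β P₀₊^γ` of weight `(a, b)`, where `γ` and `α` are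
determined by `β`. -/
def pExponents (a b : ℤ) : Finset (ℕ × ℕ × ℕ) :=
  if (a + b) % 2 = 0 ∧ 0 ≤ min a b then
    (Finset.range (((min a b) / 2).toNat + 1)).image fun i =>
      (((a - min a b) / 2).toNat + i, (min a b).toNat - 2 * i, ((b - min a b) / 2).toNat + i)
  else ∅

lemma mem_pExponents {a b : ℤ} {t : ℕ × ℕ × ℕ} :
    t ∈ pExponents a b ↔ 2 * (t.1 : ℤ) + t.2.1 = a ∧ (t.2.1 : ℤ) + 2 * t.2.2 = b := by
  obtain ⟨α, β, γ⟩ := t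
  unfold pExponents
  split_ifs with h
  · simp only [Finset.mem_image, Finset.mem_range, Prod.mk.injEq]
    constructor
    · rintro ⟨i, hi, h₁, h₂, h₃⟩
      omega
    · rintro ⟨h₁, h₂⟩
      exact ⟨min α γ, by omega, by omega, by omega, by omega⟩
  · simp only [Finset.notMem_empty, false_iff]
    omega

lemma card_pExponents (a b : ℤ) : (pExponents a b).card =
    if (a + b) % 2 = 0 ∧ 0 ≤ min a b then ((min a b) / 2).toNat + 1 else 0 := by
  unfold pExponents
  split_ifs with h
  · rw [Finset.card_image_of_injective, Finset.card_range]
    intro i j hij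
    simp only [Prod.mk.injEq] at hij
    omega
  · rfl

/-- The exponents `(α, β, γ, δ)` of the PBW basis vectors of `N(k, ℓ)` of weight `(x, y)`. -/
def pbwExponents (k l x y : ℤ) : Finset (ℕ × ℕ × ℕ × ℕ) :=
  ((Finset.range ((k - l).toNat + 1)).sigma fun δ =>
    pExponents (x - k + δ) (y - l - δ)).image fun s => (s.2.1, s.2.2.1, s.2.2.2, s.1)

lemma mem_pbwExponents {k l x y : ℤ} (hkl : l ≤ k) {t : ℕ × ℕ × ℕ × ℕ} :
    t ∈ pbwExponents k l x y ↔ (t.2.2.2 : ℤ) ≤ k - l ∧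
      k + 2 * t.1 + t.2.1 - t.2.2.2 = x ∧ l + t.2.1 + 2 * t.2.2.1 + t.2.2.2 = y := by
  obtain ⟨α, β, γ, δ⟩ := t
  simp only [pbwExponents, Finset.mem_image, Finset.mem_sigma, Finset.mem_range, mem_pExponents]
  constructor
  · rintro ⟨⟨δ', α', β', γ'⟩, h, h'⟩
    simp only [Prod.mk.injEq] at h h'
    omega
  · intro h
    exact ⟨⟨δ, α, β, γ⟩, by dsimp only at *; omega, rfl⟩

lemma card_pbwExponents (k l x y : ℤ) : (pbwExponents k l x y).card =
    ∑ δ ∈ Finset.range ((k - l).toNat + 1), (pExponents (x - k + δ) (y - l - δ)).card := by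
  rw [pbwExponents, Finset.card_image_of_injective, Finset.card_sigma]
  rintro ⟨δ, α, β, γ⟩ ⟨δ', α', β', γ'⟩ h
  simp only [Prod.mk.injEq] at h
  obtain ⟨rfl, rfl, rfl, rfl⟩ := h
  rfl

lemma card_pbwExponents_add {k l : ℤ} (hkl : l ≤ k) (x y : ℤ) :
    (pbwExponents k l x y).card + (pExponents (x - l + 1) (y - k - 1)).card =
      (pbwExponents k l (x + 1) (y - 1)).card + (pExponents (x - k) (y - l)).card := by
  have h₁ := Finset.sum_range_succ
    (fun δ : ℕ => (pExponents (x - k + δ) (y - l - δ)).card) ((k - l).toNat + 1)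
  have h₂ := Finset.sum_range_succ'
    (fun δ : ℕ => (pExponents (x - k + δ) (y - l - δ)).card) ((k - l).toNat + 1)
  have e₁ : x - k + (((k - l).toNat + 1 : ℕ) : ℤ) = x - l + 1 := by omega
  have e₂ : y - l - (((k - l).toNat + 1 : ℕ) : ℤ) = y - k - 1 := by omega
  rw [e₁, e₂] at h₁
  rw [card_pbwExponents, card_pbwExponents, ← h₁, h₂]
  simp only [Nat.cast_zero, add_zero, sub_zero, Nat.cast_add, Nat.cast_one]
  congr 1
  refine Finset.sum_congr rfl fun δ _ => ?_
  congr 2 <;> ring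

section Verma

variable {ρ : M4C →ₗ[ℂ] Module.End ℂ V} {k l : ℤ} {w : V}

lemma IsVerma.pbwVec_mem_wtSpace (h : IsVerma k l ρ w) (t : ℕ × ℕ × ℕ × ℕ) :
    pbwVec ρ w t ∈ wtSpace ρ (k + 2 * t.1 + t.2.1 - t.2.2.2)
      (l + t.2.1 + 2 * t.2.2.1 + t.2.2.2) := by
  have h₀ : w ∈ wtSpace ρ k l := mem_wtSpace.2 ⟨h.wtZ, h.wtZ'⟩
  have h₁ := h.rep.pow_map_mem_wtSpace isRootVector_NMinus h₀ t.2.2.2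
  have h₂ := h.rep.pow_map_mem_wtSpace isRootVector_P0Plus h₁ t.2.2.1
  have h₃ := h.rep.pow_map_mem_wtSpace isRootVector_P1Plus h₂ t.2.1
  have h₄ := h.rep.pow_map_mem_wtSpace isRootVector_XPlus h₃ t.1
  simp only [pbwVec, Module.End.mul_apply]
  convert h₄ using 1
  congr 1 <;> ring

lemma IsVerma.wtSpace_eq_span (h : IsVerma k l ρ w) (x y : ℤ) :
    wtSpace ρ x y = Submodule.span ℂ (pbwVec ρ w '' pbwExponents k l x y) := by
  have hb := Module.Basis.eigenspace_inf_eigenspace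
    (Module.Basis.mk h.indep fun v _ => h.spans v) (ρ ZM) (ρ ZM')
    (fun t => ((k + 2 * t.1.1 + t.1.2.1 - t.1.2.2.2 : ℤ) : ℂ))
    (fun t => ((l + t.1.2.1 + 2 * t.1.2.2.1 + t.1.2.2.2 : ℤ) : ℂ))
    (fun t => by
      rw [Module.Basis.mk_apply]; exact (mem_wtSpace.1 (h.pbwVec_mem_wtSpace t.1)).1)
    (fun t => by
      rw [Module.Basis.mk_apply]; exact (mem_wtSpace.1 (h.pbwVec_mem_wtSpace t.1)).2) x y
  rw [wtSpace, hb]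
  congr 1
  ext v
  simp only [Set.mem_image, Set.mem_ofPred_eq, Module.Basis.mk_apply, Int.cast_inj,
    Finset.mem_coe, mem_pbwExponents h.le]
  constructor
  · rintro ⟨t, ht, rfl⟩
    exact ⟨t.1, ⟨t.2, ht⟩, rfl⟩
  · rintro ⟨t, ⟨ht, ht'⟩, rfl⟩
    exact ⟨⟨t, ht⟩, ht', rfl⟩

lemma IsVerma.finiteDimensional_wtSpace (h : IsVerma k l ρ w) (x y : ℤ) :
    FiniteDimensional ℂ (wtSpace ρ x y) := by
  rw [h.wtSpace_eq_span]
  exact FiniteDimensional.span_of_finite ℂ ((pbwExponents k l x y).finite_toSet.image _)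

lemma IsVerma.finrank_wtSpace (h : IsVerma k l ρ w) (x y : ℤ) :
    Module.finrank ℂ (wtSpace ρ x y) = (pbwExponents k l x y).card := by
  have hle (t : pbwExponents k l x y) : (t.1.2.2.2 : ℤ) ≤ k - l :=
    ((mem_pbwExponents h.le).1 t.2).1
  let f (t : pbwExponents k l x y) : {t : ℕ × ℕ × ℕ × ℕ // (t.2.2.2 : ℤ) ≤ k - l} := ⟨t.1, hle t⟩
  have hf : Function.Injective f := fun s t hst => Subtype.ext (Subtype.mk.inj hst)
  have hi : LinearIndependent ℂ (fun t : pbwExponents k l x y => pbwVec ρ w t.1) :=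
    h.indep.comp f hf
  have := finrank_span_eq_card hi
  rw [h.wtSpace_eq_span, Set.image_eq_range]
  simpa using this

lemma IsVerma.wtSpace_eq_bot (h : IsVerma k l ρ w) {x y : ℤ} (hy : y < l) :
    wtSpace ρ x y = ⊥ := by
  have : pbwExponents k l x y = ∅ := by
    refine Finset.eq_empty_of_forall_notMem fun t ht => ?_
    rw [mem_pbwExponents h.le] at ht
    omega
  simp [h.wtSpace_eq_span, this]

lemma IsVerma.NPlus_pow_apply_eq_zero (h : IsVerma k l ρ w) {x y : ℤ} {v : V}
    (hv : v ∈ wtSpace ρ x y) : (ρ NPlus ^ ((y - l).toNat + 1)) v = 0 := by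
  have := h.rep.pow_map_mem_wtSpace isRootVector_NPlus hv ((y - l).toNat + 1)
  rwa [h.wtSpace_eq_bot (by push_cast; omega), Submodule.mem_bot] at this

/-- `N₊` maps the weight space `(x, y)` onto the weight space `(x + 1, y - 1)` when `x ≥ y`, so the
dimension of its kernel is a difference of weight multiplicities. -/
lemma IsVerma.finrank_hwSpace_add (h : IsVerma k l ρ w) {x y : ℤ} (hxy : y ≤ x) :
    Module.finrank ℂ (wtSpace ρ (x + 1) (y - 1)) + Module.finrank ℂ (hwSpace ρ x y) =
      Module.finrank ℂ (wtSpace ρ x y) := by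
  have := h.finiteDimensional_wtSpace x y
  have hmap : (wtSpace ρ x y).map (ρ NPlus) = wtSpace ρ (x + 1) (y - 1) := by
    apply le_antisymm
    · rintro _ ⟨v, hv, rfl⟩
      exact h.rep.map_mem_wtSpace isRootVector_NPlus hv
    · intro v hv
      obtain ⟨u, hu, rfl⟩ := h.rep.exists_NPlus_eq _ (by omega) hv (h.NPlus_pow_apply_eq_zero hv)
      exact ⟨u, by simpa using hu, rfl⟩
  have hrank := ((ρ NPlus).domRestrict (wtSpace ρ x y)).finrank_range_add_finrank_ker
  rw [LinearMap.range_domRestrict, hmap, LinearMap.ker_domRestrict] at hrank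
  rw [← hrank]
  congr 1
  exact ((Submodule.equivSubtypeMap _ _).trans
    (LinearEquiv.ofEq _ _ (Submodule.map_comap_subtype _ _))).finrank_eq.symm

end Verma

/-- The multiplicities of the `K`-types of the parabolic Verma module `N(λ)`,
`λ = (k, ℓ)`, `k ≥ ℓ`: with `mult_{(x,y)} = dim {v | Z v = x v, Z′ v = y v, N₊ v = 0}`,
one has `mult_{(x,y)} = 0` unless `x ≥ k`, `y ≥ ℓ` and `x - y ≡ k - ℓ (mod 2)`, in which
case `mult_{(x,y)} = ⌊(min(x-k, y-ℓ) + 2)/2⌋` if `y ≤ k`, and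
`mult_{(x,y)} = ⌊min(x-k, y-ℓ)/2⌋ - ⌊(y-k-1)/2⌋` if `y > k`. -/
theorem statement15 (k l : ℤ) (hkl : l ≤ k)
    (V : Type) [AddCommGroup V] [Module ℂ V]
    (ρ : M4C →ₗ[ℂ] Module.End ℂ V) (w : V) (h : IsVerma k l ρ w)
    (x y : ℤ) (hxy : y ≤ x) :
    ((x < k ∨ y < l ∨ ¬ ((x - y) % 2 = (k - l) % 2)) →
      Module.finrank ℂ (hwSpace ρ x y) = 0) ∧
    (k ≤ x → l ≤ y → (x - y) % 2 = (k - l) % 2 →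
      (Module.finrank ℂ (hwSpace ρ x y) : ℤ) =
        if y ≤ k then (min (x - k) (y - l) + 2) / 2
        else (min (x - k) (y - l)) / 2 - (y - k - 1) / 2) := by
  have h₁ := h.finrank_hwSpace_add hxy
  have h₂ := card_pbwExponents_add hkl x y
  rw [h.finrank_wtSpace, h.finrank_wtSpace] at h₁
  have h₃ : (pExponents (x - l + 1) (y - k - 1)).card + Module.finrank ℂ (hwSpace ρ x y) =
      (pExponents (x - k) (y - l)).card := by omega
  rw [card_pExponents, card_pExponents] at h₃
  constructor
  · intro h₄
    split_ifs at h₃ <;> omega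
  · intro hx hy hpar
    split_ifs at h₃ ⊢ <;> omega

end
end

section
/- Let V be a module over 𝔤, let ℓ be an integer and m a non-negative integer, and let v ∈ V satisfy Z·v = (ℓ+m)·v, Z′·v = ℓ·v and N₊·v = 0. Then each of the following elements of U(𝔤) (with parameter m for the m-dependent operators, and assuming m ≥ 2 in the cases of U and L), applied to v, yields a vector w with N₊·w = 0 of the indicated weight: P₀₋·v has weight (ℓ+m, ℓ−2); L·v has weight (ℓ+m−2, ℓ); U·v has weight (ℓ+m, ℓ+2); X₊·v has weight (ℓ+m+2, ℓ); E₊·v has weight (ℓ+m+1, ℓ+1); E₋·v has weight (ℓ+m−1, ℓ−1); D₊·v has weight (ℓ+m+2, ℓ+2); D₋·v has weight (ℓ+m−2, ℓ−2). -/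
/- Prelude: lowest weight modules for sp(4,C) -/

set_option linter.unusedVariables false

noncomputable section

open Complex

variable {V : Type} [AddCommGroup V] [Module ℂ V]

theorem sp4Gens_subset_sp4 : sp4Gens ⊆ sp4 := by
  rintro A (rfl | rfl | rfl | rfl | rfl | rfl | rfl | rfl | rfl | rfl) <;>
  · change _ = _
    simp [J4, ZM, ZM', NPlus, NMinus, XPlus, XMinus, P1Plus, P1Minus, P0Plus, P0Minus,
      ← Matrix.ext_iff, Fin.forall_fin_succ, Matrix.mul_apply, Fin.sum_univ_four]

theorem ZM_bracket :
    ZM * NMinus - NMinus * ZM = (-1 : ℂ) • NMinus ∧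
    ZM * XPlus - XPlus * ZM = (2 : ℂ) • XPlus ∧
    ZM * XMinus - XMinus * ZM = (-2 : ℂ) • XMinus ∧
    ZM * P1Plus - P1Plus * ZM = (1 : ℂ) • P1Plus ∧
    ZM * P1Minus - P1Minus * ZM = (-1 : ℂ) • P1Minus ∧
    ZM * P0Plus - P0Plus * ZM = (0 : ℂ) • P0Plus ∧
    ZM * P0Minus - P0Minus * ZM = (0 : ℂ) • P0Minus := by
  refine ⟨?_, ?_, ?_, ?_, ?_, ?_, ?_⟩ <;>
  · simp [ZM, NMinus, XPlus, XMinus, P1Plus, P1Minus, P0Plus, P0Minus,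
      funext_iff, Fin.forall_fin_succ]
    all_goals ring_nf
    all_goals norm_num [← Matrix.ext_iff, Fin.forall_fin_succ]

theorem ZM'_bracket :
    ZM' * NMinus - NMinus * ZM' = (1 : ℂ) • NMinus ∧
    ZM' * XPlus - XPlus * ZM' = (0 : ℂ) • XPlus ∧
    ZM' * XMinus - XMinus * ZM' = (0 : ℂ) • XMinus ∧
    ZM' * P1Plus - P1Plus * ZM' = (1 : ℂ) • P1Plus ∧
    ZM' * P1Minus - P1Minus * ZM' = (-1 : ℂ) • P1Minus ∧
    ZM' * P0Plus - P0Plus * ZM' = (2 : ℂ) • P0Plus ∧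
    ZM' * P0Minus - P0Minus * ZM' = (-2 : ℂ) • P0Minus := by
  refine ⟨?_, ?_, ?_, ?_, ?_, ?_, ?_⟩ <;>
  · simp [ZM', NMinus, XPlus, XMinus, P1Plus, P1Minus, P0Plus, P0Minus,
      funext_iff, Fin.forall_fin_succ]
    all_goals ring_nf
    all_goals norm_num [← Matrix.ext_iff, Fin.forall_fin_succ]

theorem NPlus_bracket :
    NPlus * NMinus - NMinus * NPlus = ZM' - ZM ∧
    NPlus * XPlus - XPlus * NPlus = 0 ∧
    NPlus * XMinus - XMinus * NPlus = -P1Minus ∧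
    NPlus * P1Plus - P1Plus * NPlus = (2 : ℂ) • XPlus ∧
    NPlus * P1Minus - P1Minus * NPlus = (-2 : ℂ) • P0Minus ∧
    NPlus * P0Plus - P0Plus * NPlus = P1Plus ∧
    NPlus * P0Minus - P0Minus * NPlus = 0 := by
  refine ⟨?_, ?_, ?_, ?_, ?_, ?_, ?_⟩ <;>
  · simp [NPlus, ZM, ZM', NMinus, XPlus, XMinus, P1Plus, P1Minus, P0Plus, P0Minus,
      funext_iff, Fin.forall_fin_succ]
    all_goals ring_nf
    all_goals norm_num [← Matrix.ext_iff, Fin.forall_fin_succ]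

theorem P1Plus_XPlus_bracket : P1Plus * XPlus - XPlus * P1Plus = 0 := by
  simp [P1Plus, XPlus]
  ring_nf
  norm_num [← Matrix.ext_iff, Fin.forall_fin_succ]

theorem P1Minus_P0Minus_bracket : P1Minus * P0Minus - P0Minus * P1Minus = 0 := by
  simp [P1Minus, P0Minus]
  ring_nf
  norm_num [← Matrix.ext_iff, Fin.forall_fin_succ]

theorem IsRep.apply_apply {ρ : M4C →ₗ[ℂ] Module.End ℂ V} (hρ : IsRep ρ) {A B C : M4C}
    (h : A * B - B * A = C) (hA : A ∈ sp4Gens := by simp [sp4Gens])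
    (hB : B ∈ sp4Gens := by simp [sp4Gens]) (x : V) :
    ρ A (ρ B x) = ρ B (ρ A x) + ρ C x := by
  have := hρ A (sp4Gens_subset_sp4 hA) B (sp4Gens_subset_sp4 hB)
  rw [h] at this
  simp [this]

/-- The operators of Table 1 take highest weight vectors to highest weight vectors, with
the indicated weights: if `v` has weight `(ℓ+m, ℓ)` and `N₊ v = 0` in a representation of
`sp₄(ℂ)`, then `P₀₋ v, L v, U v, X₊ v, E₊ v, E₋ v, D₊ v, D₋ v` are annihilated by `N₊` and
have weights `(ℓ+m, ℓ-2), (ℓ+m-2, ℓ), (ℓ+m, ℓ+2), (ℓ+m+2, ℓ), (ℓ+m+1, ℓ+1), (ℓ+m-1, ℓ-1),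
(ℓ+m+2, ℓ+2), (ℓ+m-2, ℓ-2)` respectively (assuming `m ≥ 2` for `U` and `L`). -/
theorem statement16 (V : Type) [AddCommGroup V] [Module ℂ V]
    (ρ : M4C →ₗ[ℂ] Module.End ℂ V) (hρ : IsRep ρ) (l : ℤ) (m : ℕ) (v : V)
    (hZ : ρ ZM v = ((l + m : ℤ) : ℂ) • v) (hZ' : ρ ZM' v = (l : ℂ) • v)
    (hN : ρ NPlus v = 0) :
    (ρ NPlus (ρ P0Minus v) = 0 ∧
      ρ ZM (ρ P0Minus v) = ((l + m : ℤ) : ℂ) • ρ P0Minus v ∧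
      ρ ZM' (ρ P0Minus v) = ((l - 2 : ℤ) : ℂ) • ρ P0Minus v) ∧
    (2 ≤ m →
      ρ NPlus (opL ρ (m : ℤ) v) = 0 ∧
      ρ ZM (opL ρ (m : ℤ) v) = ((l + m - 2 : ℤ) : ℂ) • opL ρ (m : ℤ) v ∧
      ρ ZM' (opL ρ (m : ℤ) v) = ((l : ℤ) : ℂ) • opL ρ (m : ℤ) v) ∧
    (2 ≤ m →
      ρ NPlus (opU ρ (m : ℤ) v) = 0 ∧
      ρ ZM (opU ρ (m : ℤ) v) = ((l + m : ℤ) : ℂ) • opU ρ (m : ℤ) v ∧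
      ρ ZM' (opU ρ (m : ℤ) v) = ((l + 2 : ℤ) : ℂ) • opU ρ (m : ℤ) v) ∧
    (ρ NPlus (ρ XPlus v) = 0 ∧
      ρ ZM (ρ XPlus v) = ((l + m + 2 : ℤ) : ℂ) • ρ XPlus v ∧
      ρ ZM' (ρ XPlus v) = ((l : ℤ) : ℂ) • ρ XPlus v) ∧
    (ρ NPlus (opEp ρ (m : ℤ) v) = 0 ∧
      ρ ZM (opEp ρ (m : ℤ) v) = ((l + m + 1 : ℤ) : ℂ) • opEp ρ (m : ℤ) v ∧
      ρ ZM' (opEp ρ (m : ℤ) v) = ((l + 1 : ℤ) : ℂ) • opEp ρ (m : ℤ) v) ∧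
    (ρ NPlus (opEm ρ (m : ℤ) v) = 0 ∧
      ρ ZM (opEm ρ (m : ℤ) v) = ((l + m - 1 : ℤ) : ℂ) • opEm ρ (m : ℤ) v ∧
      ρ ZM' (opEm ρ (m : ℤ) v) = ((l - 1 : ℤ) : ℂ) • opEm ρ (m : ℤ) v) ∧
    (ρ NPlus (opDp ρ v) = 0 ∧
      ρ ZM (opDp ρ v) = ((l + m + 2 : ℤ) : ℂ) • opDp ρ v ∧
      ρ ZM' (opDp ρ v) = ((l + 2 : ℤ) : ℂ) • opDp ρ v) ∧
    (ρ NPlus (opDm ρ v) = 0 ∧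
      ρ ZM (opDm ρ v) = ((l + m - 2 : ℤ) : ℂ) • opDm ρ v ∧
      ρ ZM' (opDm ρ v) = ((l - 2 : ℤ) : ℂ) • opDm ρ v) := by
  obtain ⟨z1, z2, z3, z4, z5, z6, z7⟩ := ZM_bracket
  obtain ⟨y1, y2, y3, y4, y5, y6, y7⟩ := ZM'_bracket
  obtain ⟨n1, n2, n3, n4, n5, n6, n7⟩ := NPlus_bracket
  replace z1 := hρ.apply_apply z1
  replace z2 := hρ.apply_apply z2
  replace z3 := hρ.apply_apply z3
  replace z4 := hρ.apply_apply z4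
  replace z5 := hρ.apply_apply z5
  replace z6 := hρ.apply_apply z6
  replace z7 := hρ.apply_apply z7
  replace y1 := hρ.apply_apply y1
  replace y2 := hρ.apply_apply y2
  replace y3 := hρ.apply_apply y3
  replace y4 := hρ.apply_apply y4
  replace y5 := hρ.apply_apply y5
  replace y6 := hρ.apply_apply y6
  replace y7 := hρ.apply_apply y7
  replace n1 := hρ.apply_apply n1
  replace n2 := hρ.apply_apply n2
  replace n3 := hρ.apply_apply n3
  replace n4 := hρ.apply_apply n4
  replace n5 := hρ.apply_apply n5
  replace n6 := hρ.apply_apply n6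
  replace n7 := hρ.apply_apply n7
  have c₁ := hρ.apply_apply P1Plus_XPlus_bracket
  have c₂ := hρ.apply_apply P1Minus_P0Minus_bracket
  refine ⟨⟨?_, ?_, ?_⟩, fun _ => ⟨?_, ?_, ?_⟩, fun _ => ⟨?_, ?_, ?_⟩, ⟨?_, ?_, ?_⟩, ⟨?_, ?_, ?_⟩,
    ⟨?_, ?_, ?_⟩, ⟨?_, ?_, ?_⟩, ⟨?_, ?_, ?_⟩⟩ <;>
  · simp only [opL, opU, opEp, opEm, opDp, opDm, pow_two, LinearMap.add_apply, LinearMap.sub_apply,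
      LinearMap.smul_apply, Module.End.mul_apply, LinearMap.neg_apply, LinearMap.zero_apply,
      map_add, map_sub, map_neg, map_smul, map_zero, hZ, hZ', hN, c₁, c₂,
      z1, z2, z3, z4, z5, z6, z7, y1, y2, y3, y4, y5, y6, y7, n1, n2, n3, n4, n5, n6, n7]
    push_cast
    module

end
end

section
/- Let λ = (ℓ+m, ℓ) with m ≥ 0 even and ℓ ≥ 1, and if ℓ = 1 assume furthermore that m = 0. Let w₀ be a non-zero vector of the parabolic Verma module N(λ) of weight (ℓ+m, ℓ) with N₊·w₀ = 0. Then for every integer β ≥ 0, the vector P₀₋^{m/2}·D₋^β·D₊^β·U^{m/2}·w₀ is a non-zero scalar multiple of w₀ (in each application of an m-dependent operator the parameter is updated to match the weight of the argument). -/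
/- Prelude: lowest weight modules for sp(4,C) -/

set_option linter.unusedVariables false

noncomputable section

open Complex

variable {V : Type} [AddCommGroup V] [Module ℂ V]

set_option linter.unusedSimpArgs false

/-- The element of `sp₄(ℂ)` with given coordinates in the standard basis. -/
def sp4Comb (c : Fin 10 → ℂ) : M4C :=
  c 0 • ZM + c 1 • ZM' + c 2 • NPlus + c 3 • NMinus + c 4 • XPlus + c 5 • XMinus +
    c 6 • P1Plus + c 7 • P1Minus + c 8 • P0Plus + c 9 • P0Minus

/-- The structure constants of `sp₄(ℂ)` in the standard basis. -/
def sp4Bracket (c d : Fin 10 → ℂ) : Fin 10 → ℂ :=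
  ![- (c 2 * d 3 - c 3 * d 2) + (c 4 * d 5 - c 5 * d 4) + (c 6 * d 7 - c 7 * d 6),
    (c 2 * d 3 - c 3 * d 2) + (c 6 * d 7 - c 7 * d 6) + (c 8 * d 9 - c 9 * d 8),
    (c 0 * d 2 - c 2 * d 0) - (c 1 * d 2 - c 2 * d 1) + (c 4 * d 7 - c 7 * d 4) + (c 6 * d 9 - c 9 * d 6),
    - (c 0 * d 3 - c 3 * d 0) + (c 1 * d 3 - c 3 * d 1) + (c 5 * d 6 - c 6 * d 5) + (c 7 * d 8 - c 8 * d 7),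
    2 * (c 0 * d 4 - c 4 * d 0) + 2 * (c 2 * d 6 - c 6 * d 2),
    - 2 * (c 0 * d 5 - c 5 * d 0) + 2 * (c 3 * d 7 - c 7 * d 3),
    (c 0 * d 6 - c 6 * d 0) + (c 1 * d 6 - c 6 * d 1) + (c 2 * d 8 - c 8 * d 2) - (c 3 * d 4 - c 4 * d 3),
    - (c 0 * d 7 - c 7 * d 0) - (c 1 * d 7 - c 7 * d 1) - (c 2 * d 5 - c 5 * d 2) + (c 3 * d 9 - c 9 * d 3),
    2 * (c 1 * d 8 - c 8 * d 1) - 2 * (c 3 * d 6 - c 6 * d 3),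
    - 2 * (c 1 * d 9 - c 9 * d 1) - 2 * (c 2 * d 7 - c 7 * d 2)]

lemma sp4Comb_eq (c : Fin 10 → ℂ) :
    sp4Comb c =
      !![(c 4 + c 5) / 2, (c 2 + c 3 + c 6 + c 7) / 2,
          I * ((c 4 - c 5) / 2 - c 0), I * ((c 3 - c 2 + c 6 - c 7) / 2);
        (c 6 + c 7 - c 2 - c 3) / 2, (c 8 + c 9) / 2,
          I * ((c 3 - c 2 + c 6 - c 7) / 2), I * ((c 8 - c 9) / 2 - c 1);
        I * ((c 4 - c 5) / 2 + c 0), I * ((c 2 - c 3 + c 6 - c 7) / 2),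
          -((c 4 + c 5) / 2), -((c 6 + c 7 - c 2 - c 3) / 2);
        I * ((c 2 - c 3 + c 6 - c 7) / 2), I * ((c 8 - c 9) / 2 + c 1),
          -((c 2 + c 3 + c 6 + c 7) / 2), -((c 8 + c 9) / 2)] := by
  ext i j
  fin_cases i <;> fin_cases j <;>
    simp [sp4Comb, ZM, ZM', NPlus, NMinus, XPlus, XMinus, P1Plus, P1Minus, P0Plus, P0Minus] <;>
    ring

lemma sp4Comb_mem_sp4 (c : Fin 10 → ℂ) : sp4Comb c ∈ sp4 := by
  rw [sp4Comb_eq]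
  ext i j
  fin_cases i <;> fin_cases j <;> simp [J4, Matrix.mul_apply, Fin.sum_univ_four]

set_option maxHeartbeats 1000000 in
lemma sp4Comb_bracket (c d : Fin 10 → ℂ) :
    sp4Comb c * sp4Comb d - sp4Comb d * sp4Comb c = sp4Comb (sp4Bracket c d) := by
  have hI (x y : ℂ) : I * x * (I * y) = -(x * y) := by linear_combination x * y * I_mul_I
  simp only [sp4Comb_eq]
  ext i j
  fin_cases i <;> fin_cases j <;> simp [sp4Bracket, hI] <;> ring

namespace IsRep

variable {ρ : M4C →ₗ[ℂ] Module.End ℂ V}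

lemma apply_apply_s18 (h : IsRep ρ) (c d : Fin 10 → ℂ) (x : V) :
    ρ (sp4Comb c) (ρ (sp4Comb d) x) =
      ρ (sp4Comb d) (ρ (sp4Comb c) x) + ρ (sp4Comb (sp4Bracket c d)) x := by
  have := LinearMap.congr_fun (h _ (sp4Comb_mem_sp4 c) _ (sp4Comb_mem_sp4 d)) x
  rw [sp4Comb_bracket] at this
  simp only [LinearMap.sub_apply, Module.End.mul_apply] at this
  rw [this]
  abel

/-- The commutation rules of the elements of `𝔭₊` with each other. -/
lemma comm_plus (h : IsRep ρ) :
    (∀ x, ρ P1Plus (ρ XPlus x) = ρ XPlus (ρ P1Plus x)) ∧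
    (∀ x, ρ P0Plus (ρ XPlus x) = ρ XPlus (ρ P0Plus x)) ∧
    (∀ x, ρ P0Plus (ρ P1Plus x) = ρ P1Plus (ρ P0Plus x)) := by
  refine ⟨fun x ↦ ?_, fun x ↦ ?_, fun x ↦ ?_⟩
  · simpa [sp4Comb, sp4Bracket, sub_eq_add_neg, add_assoc]
      using h.apply_apply_s18 (Pi.single 6 1) (Pi.single 4 1) x
  · simpa [sp4Comb, sp4Bracket, sub_eq_add_neg, add_assoc]
      using h.apply_apply_s18 (Pi.single 8 1) (Pi.single 4 1) x
  · simpa [sp4Comb, sp4Bracket, sub_eq_add_neg, add_assoc]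
      using h.apply_apply_s18 (Pi.single 8 1) (Pi.single 6 1) x

/-- The commutation rules of `N₋` with `𝔭₊`. -/
lemma comm_NMinus (h : IsRep ρ) :
    (∀ x, ρ NMinus (ρ XPlus x) = ρ XPlus (ρ NMinus x) - ρ P1Plus x) ∧
    (∀ x, ρ NMinus (ρ P1Plus x) = ρ P1Plus (ρ NMinus x) - (2 : ℂ) • ρ P0Plus x) ∧
    (∀ x, ρ NMinus (ρ P0Plus x) = ρ P0Plus (ρ NMinus x)) := by
  refine ⟨fun x ↦ ?_, fun x ↦ ?_, fun x ↦ ?_⟩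
  · simpa [sp4Comb, sp4Bracket, sub_eq_add_neg, add_assoc]
      using h.apply_apply_s18 (Pi.single 3 1) (Pi.single 4 1) x
  · simpa [sp4Comb, sp4Bracket, sub_eq_add_neg, add_assoc]
      using h.apply_apply_s18 (Pi.single 3 1) (Pi.single 6 1) x
  · simpa [sp4Comb, sp4Bracket, sub_eq_add_neg, add_assoc]
      using h.apply_apply_s18 (Pi.single 3 1) (Pi.single 8 1) x

/-- The commutation rules of `N₊` with `𝔭₊` and `N₋`. -/
lemma comm_NPlus (h : IsRep ρ) :
    (∀ x, ρ NPlus (ρ XPlus x) = ρ XPlus (ρ NPlus x)) ∧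
    (∀ x, ρ NPlus (ρ P1Plus x) = ρ P1Plus (ρ NPlus x) + (2 : ℂ) • ρ XPlus x) ∧
    (∀ x, ρ NPlus (ρ P0Plus x) = ρ P0Plus (ρ NPlus x) + ρ P1Plus x) ∧
    (∀ x, ρ NPlus (ρ NMinus x) = ρ NMinus (ρ NPlus x) - ρ ZM x + ρ ZM' x) := by
  refine ⟨fun x ↦ ?_, fun x ↦ ?_, fun x ↦ ?_, fun x ↦ ?_⟩
  · simpa [sp4Comb, sp4Bracket, sub_eq_add_neg, add_assoc]
      using h.apply_apply_s18 (Pi.single 2 1) (Pi.single 4 1) x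
  · simpa [sp4Comb, sp4Bracket, sub_eq_add_neg, add_assoc]
      using h.apply_apply_s18 (Pi.single 2 1) (Pi.single 6 1) x
  · simpa [sp4Comb, sp4Bracket, sub_eq_add_neg, add_assoc]
      using h.apply_apply_s18 (Pi.single 2 1) (Pi.single 8 1) x
  · simpa [sp4Comb, sp4Bracket, sub_eq_add_neg, add_assoc]
      using h.apply_apply_s18 (Pi.single 2 1) (Pi.single 3 1) x

/-- The commutation rules of `Z` with `𝔭₊` and `N₋`. -/
lemma comm_ZM (h : IsRep ρ) :
    (∀ x, ρ ZM (ρ XPlus x) = ρ XPlus (ρ ZM x) + (2 : ℂ) • ρ XPlus x) ∧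
    (∀ x, ρ ZM (ρ P1Plus x) = ρ P1Plus (ρ ZM x) + ρ P1Plus x) ∧
    (∀ x, ρ ZM (ρ P0Plus x) = ρ P0Plus (ρ ZM x)) ∧
    (∀ x, ρ ZM (ρ NMinus x) = ρ NMinus (ρ ZM x) - ρ NMinus x) := by
  refine ⟨fun x ↦ ?_, fun x ↦ ?_, fun x ↦ ?_, fun x ↦ ?_⟩
  · simpa [sp4Comb, sp4Bracket, sub_eq_add_neg, add_assoc]
      using h.apply_apply_s18 (Pi.single 0 1) (Pi.single 4 1) x
  · simpa [sp4Comb, sp4Bracket, sub_eq_add_neg, add_assoc]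
      using h.apply_apply_s18 (Pi.single 0 1) (Pi.single 6 1) x
  · simpa [sp4Comb, sp4Bracket, sub_eq_add_neg, add_assoc]
      using h.apply_apply_s18 (Pi.single 0 1) (Pi.single 8 1) x
  · simpa [sp4Comb, sp4Bracket, sub_eq_add_neg, add_assoc]
      using h.apply_apply_s18 (Pi.single 0 1) (Pi.single 3 1) x

/-- The commutation rules of `Z′` with `𝔭₊` and `N₋`. -/
lemma comm_ZM' (h : IsRep ρ) :
    (∀ x, ρ ZM' (ρ XPlus x) = ρ XPlus (ρ ZM' x)) ∧
    (∀ x, ρ ZM' (ρ P1Plus x) = ρ P1Plus (ρ ZM' x) + ρ P1Plus x) ∧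
    (∀ x, ρ ZM' (ρ P0Plus x) = ρ P0Plus (ρ ZM' x) + (2 : ℂ) • ρ P0Plus x) ∧
    (∀ x, ρ ZM' (ρ NMinus x) = ρ NMinus (ρ ZM' x) + ρ NMinus x) := by
  refine ⟨fun x ↦ ?_, fun x ↦ ?_, fun x ↦ ?_, fun x ↦ ?_⟩
  · simpa [sp4Comb, sp4Bracket, sub_eq_add_neg, add_assoc]
      using h.apply_apply_s18 (Pi.single 1 1) (Pi.single 4 1) x
  · simpa [sp4Comb, sp4Bracket, sub_eq_add_neg, add_assoc]
      using h.apply_apply_s18 (Pi.single 1 1) (Pi.single 6 1) x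
  · simpa [sp4Comb, sp4Bracket, sub_eq_add_neg, add_assoc]
      using h.apply_apply_s18 (Pi.single 1 1) (Pi.single 8 1) x
  · simpa [sp4Comb, sp4Bracket, sub_eq_add_neg, add_assoc]
      using h.apply_apply_s18 (Pi.single 1 1) (Pi.single 3 1) x

/-- The commutation rules of `P₀₋` with `𝔭₊` and `N₋`. -/
lemma comm_P0Minus (h : IsRep ρ) :
    (∀ x, ρ P0Minus (ρ XPlus x) = ρ XPlus (ρ P0Minus x)) ∧
    (∀ x, ρ P0Minus (ρ P1Plus x) = ρ P1Plus (ρ P0Minus x) - ρ NPlus x) ∧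
    (∀ x, ρ P0Minus (ρ P0Plus x) = ρ P0Plus (ρ P0Minus x) - ρ ZM' x) ∧
    (∀ x, ρ P0Minus (ρ NMinus x) = ρ NMinus (ρ P0Minus x) - ρ P1Minus x) := by
  refine ⟨fun x ↦ ?_, fun x ↦ ?_, fun x ↦ ?_, fun x ↦ ?_⟩
  · simpa [sp4Comb, sp4Bracket, sub_eq_add_neg, add_assoc]
      using h.apply_apply_s18 (Pi.single 9 1) (Pi.single 4 1) x
  · simpa [sp4Comb, sp4Bracket, sub_eq_add_neg, add_assoc]
      using h.apply_apply_s18 (Pi.single 9 1) (Pi.single 6 1) x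
  · simpa [sp4Comb, sp4Bracket, sub_eq_add_neg, add_assoc]
      using h.apply_apply_s18 (Pi.single 9 1) (Pi.single 8 1) x
  · simpa [sp4Comb, sp4Bracket, sub_eq_add_neg, add_assoc]
      using h.apply_apply_s18 (Pi.single 9 1) (Pi.single 3 1) x

/-- The commutation rules of `P₁₋` with `𝔭₊` and `N₋`. -/
lemma comm_P1Minus (h : IsRep ρ) :
    (∀ x, ρ P1Minus (ρ XPlus x) = ρ XPlus (ρ P1Minus x) - ρ NPlus x) ∧
    (∀ x, ρ P1Minus (ρ P1Plus x) = ρ P1Plus (ρ P1Minus x) - ρ ZM x - ρ ZM' x) ∧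
    (∀ x, ρ P1Minus (ρ P0Plus x) = ρ P0Plus (ρ P1Minus x) + ρ NMinus x) ∧
    (∀ x, ρ P1Minus (ρ NMinus x) = ρ NMinus (ρ P1Minus x) - (2 : ℂ) • ρ XMinus x) := by
  refine ⟨fun x ↦ ?_, fun x ↦ ?_, fun x ↦ ?_, fun x ↦ ?_⟩
  · simpa [sp4Comb, sp4Bracket, sub_eq_add_neg, add_assoc]
      using h.apply_apply_s18 (Pi.single 7 1) (Pi.single 4 1) x
  · simpa [sp4Comb, sp4Bracket, sub_eq_add_neg, add_assoc]
      using h.apply_apply_s18 (Pi.single 7 1) (Pi.single 6 1) x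
  · simpa [sp4Comb, sp4Bracket, sub_eq_add_neg, add_assoc]
      using h.apply_apply_s18 (Pi.single 7 1) (Pi.single 8 1) x
  · simpa [sp4Comb, sp4Bracket, sub_eq_add_neg, add_assoc]
      using h.apply_apply_s18 (Pi.single 7 1) (Pi.single 3 1) x

/-- The commutation rules of `X₋` with `𝔭₊` and `N₋`. -/
lemma comm_XMinus (h : IsRep ρ) :
    (∀ x, ρ XMinus (ρ XPlus x) = ρ XPlus (ρ XMinus x) - ρ ZM x) ∧
    (∀ x, ρ XMinus (ρ P1Plus x) = ρ P1Plus (ρ XMinus x) + ρ NMinus x) ∧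
    (∀ x, ρ XMinus (ρ P0Plus x) = ρ P0Plus (ρ XMinus x)) ∧
    (∀ x, ρ XMinus (ρ NMinus x) = ρ NMinus (ρ XMinus x)) := by
  refine ⟨fun x ↦ ?_, fun x ↦ ?_, fun x ↦ ?_, fun x ↦ ?_⟩
  · simpa [sp4Comb, sp4Bracket, sub_eq_add_neg, add_assoc]
      using h.apply_apply_s18 (Pi.single 5 1) (Pi.single 4 1) x
  · simpa [sp4Comb, sp4Bracket, sub_eq_add_neg, add_assoc]
      using h.apply_apply_s18 (Pi.single 5 1) (Pi.single 6 1) x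
  · simpa [sp4Comb, sp4Bracket, sub_eq_add_neg, add_assoc]
      using h.apply_apply_s18 (Pi.single 5 1) (Pi.single 8 1) x
  · simpa [sp4Comb, sp4Bracket, sub_eq_add_neg, add_assoc]
      using h.apply_apply_s18 (Pi.single 5 1) (Pi.single 3 1) x

/-- The commutation rules of the elements of `𝔭₋` with each other. -/
lemma comm_minus (h : IsRep ρ) :
    (∀ x, ρ P1Minus (ρ XMinus x) = ρ XMinus (ρ P1Minus x)) ∧
    (∀ x, ρ P0Minus (ρ XMinus x) = ρ XMinus (ρ P0Minus x)) ∧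
    (∀ x, ρ P0Minus (ρ P1Minus x) = ρ P1Minus (ρ P0Minus x)) := by
  refine ⟨fun x ↦ ?_, fun x ↦ ?_, fun x ↦ ?_⟩
  · simpa [sp4Comb, sp4Bracket, sub_eq_add_neg, add_assoc]
      using h.apply_apply_s18 (Pi.single 7 1) (Pi.single 5 1) x
  · simpa [sp4Comb, sp4Bracket, sub_eq_add_neg, add_assoc]
      using h.apply_apply_s18 (Pi.single 9 1) (Pi.single 5 1) x
  · simpa [sp4Comb, sp4Bracket, sub_eq_add_neg, add_assoc]
      using h.apply_apply_s18 (Pi.single 9 1) (Pi.single 7 1) x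

/-- The commutation rules of `N₊` with `𝔭₋`. -/
lemma comm_NPlus_minus (h : IsRep ρ) :
    (∀ x, ρ NPlus (ρ P0Minus x) = ρ P0Minus (ρ NPlus x)) ∧
    (∀ x, ρ NPlus (ρ P1Minus x) = ρ P1Minus (ρ NPlus x) - (2 : ℂ) • ρ P0Minus x) ∧
    (∀ x, ρ NPlus (ρ XMinus x) = ρ XMinus (ρ NPlus x) - ρ P1Minus x) := by
  refine ⟨fun x ↦ ?_, fun x ↦ ?_, fun x ↦ ?_⟩
  · simpa [sp4Comb, sp4Bracket, sub_eq_add_neg, add_assoc]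
      using h.apply_apply_s18 (Pi.single 2 1) (Pi.single 9 1) x
  · simpa [sp4Comb, sp4Bracket, sub_eq_add_neg, add_assoc]
      using h.apply_apply_s18 (Pi.single 2 1) (Pi.single 7 1) x
  · simpa [sp4Comb, sp4Bracket, sub_eq_add_neg, add_assoc]
      using h.apply_apply_s18 (Pi.single 2 1) (Pi.single 5 1) x

/-- The commutation rules of `Z` with `𝔭₋`. -/
lemma comm_ZM_minus (h : IsRep ρ) :
    (∀ x, ρ ZM (ρ P0Minus x) = ρ P0Minus (ρ ZM x)) ∧
    (∀ x, ρ ZM (ρ P1Minus x) = ρ P1Minus (ρ ZM x) - ρ P1Minus x) ∧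
    (∀ x, ρ ZM (ρ XMinus x) = ρ XMinus (ρ ZM x) - (2 : ℂ) • ρ XMinus x) := by
  refine ⟨fun x ↦ ?_, fun x ↦ ?_, fun x ↦ ?_⟩
  · simpa [sp4Comb, sp4Bracket, sub_eq_add_neg, add_assoc]
      using h.apply_apply_s18 (Pi.single 0 1) (Pi.single 9 1) x
  · simpa [sp4Comb, sp4Bracket, sub_eq_add_neg, add_assoc]
      using h.apply_apply_s18 (Pi.single 0 1) (Pi.single 7 1) x
  · simpa [sp4Comb, sp4Bracket, sub_eq_add_neg, add_assoc]
      using h.apply_apply_s18 (Pi.single 0 1) (Pi.single 5 1) x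

/-- The commutation rules of `Z′` with `𝔭₋`. -/
lemma comm_ZM'_minus (h : IsRep ρ) :
    (∀ x, ρ ZM' (ρ P0Minus x) = ρ P0Minus (ρ ZM' x) - (2 : ℂ) • ρ P0Minus x) ∧
    (∀ x, ρ ZM' (ρ P1Minus x) = ρ P1Minus (ρ ZM' x) - ρ P1Minus x) ∧
    (∀ x, ρ ZM' (ρ XMinus x) = ρ XMinus (ρ ZM' x)) := by
  refine ⟨fun x ↦ ?_, fun x ↦ ?_, fun x ↦ ?_⟩
  · simpa [sp4Comb, sp4Bracket, sub_eq_add_neg, add_assoc]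
      using h.apply_apply_s18 (Pi.single 1 1) (Pi.single 9 1) x
  · simpa [sp4Comb, sp4Bracket, sub_eq_add_neg, add_assoc]
      using h.apply_apply_s18 (Pi.single 1 1) (Pi.single 7 1) x
  · simpa [sp4Comb, sp4Bracket, sub_eq_add_neg, add_assoc]
      using h.apply_apply_s18 (Pi.single 1 1) (Pi.single 5 1) x

end IsRep

/-- The data describing the action of `𝔭₋` on a vector `v` of weight `(b + m, b)` obtained by
applying the operator `U` to `y`. -/
structure LowerData (ρ : M4C →ₗ[ℂ] Module.End ℂ V) (m : ℤ) (b t : ℂ) (v y : V) : Prop where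
  wtZ : ρ ZM v = (b + m) • v
  wtZ' : ρ ZM' v = b • v
  annNPlus : ρ NPlus v = 0
  p0Minus : ρ P0Minus v = ((m + 2) * (m + 1) * t) • y
  p1Minus : ρ P1Minus v = (2 * (m + 1) * t) • ρ NMinus y
  xMinus : ρ XMinus v = t • ρ NMinus (ρ NMinus y)
  smul_eq : t • v = t • opU ρ (m + 2) y
  dMinus : opDm ρ v = 0

namespace LowerData

variable {ρ : M4C →ₗ[ℂ] Module.End ℂ V} {m : ℤ} {b t : ℂ} {v y : V}

lemma opU_apply (h : IsRep ρ) (d : LowerData ρ m b t v y) :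
    LowerData ρ (m - 2) (b + 2) (t - (b - 1)) (opU ρ m v) v := by
  have hU (n : ℤ) (x : V) : opU ρ n x = ((n : ℂ) * (n - 1)) • ρ P0Plus x
      + ((n : ℂ) - 1) • ρ P1Plus (ρ NMinus x) + ρ XPlus (ρ NMinus (ρ NMinus x)) := by
    simp [opU, pow_two]
  have hv := d.smul_eq
  have hNv := congrArg (ρ NMinus) d.smul_eq
  have hNNv := congrArg (ρ NMinus) hNv
  simp only [hU, map_add, map_sub, map_smul, smul_add, smul_sub, smul_smul, h.comm_NMinus] at hv hNv hNNv
  push_cast at hv hNv hNNv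
  have p0 : ρ P0Minus (opU ρ m v) = (m * (m - 1) * (t - (b - 1))) • v := by
    simp only [hU, map_add, map_sub, map_smul, smul_add, smul_sub, smul_smul, h.comm_plus, h.comm_NMinus, h.comm_NPlus, h.comm_ZM, h.comm_ZM', h.comm_P0Minus, h.comm_P1Minus,
      h.comm_XMinus,
      d.wtZ, d.wtZ', d.annNPlus, d.p0Minus, d.p1Minus, d.xMinus, map_zero]
    linear_combination (norm := module) (-(m : ℂ) * (m - 1)) • hv
  have p1 : ρ P1Minus (opU ρ m v) = (2 * (m - 1) * (t - (b - 1))) • ρ NMinus v := by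
    simp only [hU, map_add, map_sub, map_smul, smul_add, smul_sub, smul_smul, h.comm_plus, h.comm_NMinus, h.comm_NPlus, h.comm_ZM, h.comm_ZM', h.comm_P0Minus, h.comm_P1Minus,
      h.comm_XMinus,
      d.wtZ, d.wtZ', d.annNPlus, d.p0Minus, d.p1Minus, d.xMinus, map_zero]
    linear_combination (norm := module) (-2 * ((m : ℂ) - 1)) • hNv
  have x : ρ XMinus (opU ρ m v) = (t - (b - 1)) • ρ NMinus (ρ NMinus v) := by
    simp only [hU, map_add, map_sub, map_smul, smul_add, smul_sub, smul_smul, h.comm_plus, h.comm_NMinus, h.comm_NPlus, h.comm_ZM, h.comm_ZM', h.comm_P0Minus, h.comm_P1Minus,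
      h.comm_XMinus,
      d.wtZ, d.wtZ', d.annNPlus, d.p0Minus, d.p1Minus, d.xMinus, map_zero]
    linear_combination (norm := module) (-1 : ℂ) • hNNv
  refine ⟨?_, ?_, ?_, ?_, ?_, x, by simp, ?_⟩
  · simp only [hU, map_add, map_sub, map_smul, smul_add, smul_sub, smul_smul, h.comm_plus, h.comm_NMinus, h.comm_NPlus, h.comm_ZM, h.comm_ZM', h.comm_P0Minus, h.comm_P1Minus,
      h.comm_XMinus, d.wtZ]
    push_cast
    module
  · simp only [hU, map_add, map_sub, map_smul, smul_add, smul_sub, smul_smul, h.comm_plus, h.comm_NMinus, h.comm_NPlus, h.comm_ZM, h.comm_ZM', h.comm_P0Minus, h.comm_P1Minus,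
      h.comm_XMinus, d.wtZ']
    module
  · simp only [hU, map_add, map_sub, map_smul, smul_add, smul_sub, smul_smul, h.comm_plus, h.comm_NMinus, h.comm_NPlus, h.comm_ZM, h.comm_ZM', h.comm_P0Minus, h.comm_P1Minus,
      h.comm_XMinus,
      d.wtZ, d.wtZ', d.annNPlus, map_zero]
    module
  · rw [p0]; push_cast; module
  · rw [p1]; push_cast; module
  · simp only [opDm, pow_two, LinearMap.sub_apply, LinearMap.smul_apply, Module.End.mul_apply,
      p0, p1, map_smul, h.comm_plus, h.comm_NMinus, h.comm_NPlus, h.comm_ZM, h.comm_ZM', h.comm_P0Minus, h.comm_P1Minus,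
      h.comm_XMinus, d.p0Minus, d.p1Minus, d.xMinus, map_sub]
    module

end LowerData

/-- The data of a vector of weight `(n, n)` spanning a one-dimensional `𝔨`-module on which
`X₊X₋ + ½ P₁₊P₁₋ + P₀₊P₀₋` acts by the scalar `e`. -/
structure ScalarData (ρ : M4C →ₗ[ℂ] Module.End ℂ V) (n e : ℂ) (v : V) : Prop where
  wtZ : ρ ZM v = n • v
  wtZ' : ρ ZM' v = n • v
  annNPlus : ρ NPlus v = 0
  annNMinus : ρ NMinus v = 0
  quad : ρ XPlus (ρ XMinus v) + (2⁻¹ : ℂ) • ρ P1Plus (ρ P1Minus v) + ρ P0Plus (ρ P0Minus v)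
    = e • v

lemma opDp_eq (ρ : M4C →ₗ[ℂ] Module.End ℂ V) (x : V) :
    opDp ρ x = ρ P1Plus (ρ P1Plus x) - (4 : ℂ) • ρ XPlus (ρ P0Plus x) := by
  simp [opDp, pow_two]

lemma opDm_eq (ρ : M4C →ₗ[ℂ] Module.End ℂ V) (x : V) :
    opDm ρ x = ρ P1Minus (ρ P1Minus x) - (4 : ℂ) • ρ XMinus (ρ P0Minus x) := by
  simp [opDm, pow_two]

namespace ScalarData

variable {ρ : M4C →ₗ[ℂ] Module.End ℂ V} {n e : ℂ} {v : V}

lemma opDp_apply (h : IsRep ρ) (d : ScalarData ρ n e v) :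
    ScalarData ρ (n + 2) (e + 1 - 2 * n) (opDp ρ v) := by
  have h0 : ρ NMinus (ρ P0Minus v) = ρ P1Minus v := by
    have := h.comm_P0Minus.2.2.2 v
    rw [d.annNMinus, map_zero] at this
    exact sub_eq_zero.mp this.symm
  have h1 : ρ NMinus (ρ P1Minus v) = (2 : ℂ) • ρ XMinus v := by
    have := h.comm_P1Minus.2.2.2 v
    rw [d.annNMinus, map_zero] at this
    exact sub_eq_zero.mp this.symm
  have h2 : ρ NMinus (ρ XMinus v) = 0 := by
    rw [← h.comm_XMinus.2.2.2, d.annNMinus, map_zero]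
  have hq := congrArg (opDp ρ) d.quad
  simp only [opDp_eq, map_add, map_sub, map_smul, smul_add, smul_sub, smul_smul, h.comm_plus, h.comm_NMinus, h.comm_NPlus, h.comm_ZM, h.comm_ZM', h.comm_P0Minus, h.comm_P1Minus,
      h.comm_XMinus] at hq
  constructor
  · simp only [opDp_eq, map_sub, map_add, map_smul, h.comm_plus, h.comm_NMinus, h.comm_NPlus, h.comm_ZM, h.comm_ZM', h.comm_P0Minus, h.comm_P1Minus,
      h.comm_XMinus, d.wtZ]
    module
  · simp only [opDp_eq, map_sub, map_add, map_smul, h.comm_plus, h.comm_NMinus, h.comm_NPlus, h.comm_ZM, h.comm_ZM', h.comm_P0Minus, h.comm_P1Minus,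
      h.comm_XMinus, d.wtZ']
    module
  · simp only [opDp_eq, map_sub, map_add, map_smul, h.comm_plus, h.comm_NMinus, h.comm_NPlus, h.comm_ZM, h.comm_ZM', h.comm_P0Minus, h.comm_P1Minus,
      h.comm_XMinus, d.annNPlus, map_zero]
    module
  · simp only [opDp_eq, map_sub, map_add, map_smul, h.comm_plus, h.comm_NMinus, h.comm_NPlus, h.comm_ZM, h.comm_ZM', h.comm_P0Minus, h.comm_P1Minus,
      h.comm_XMinus, d.annNMinus, map_zero]
    module
  · simp only [opDp_eq, map_sub, map_add, map_smul, h.comm_plus, h.comm_NMinus, h.comm_NPlus, h.comm_ZM, h.comm_ZM', h.comm_P0Minus, h.comm_P1Minus,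
      h.comm_XMinus, h.comm_NPlus_minus, h.comm_ZM_minus,
      h.comm_ZM'_minus, d.wtZ, d.wtZ', d.annNPlus, d.annNMinus, h0, h1, h2, map_zero]
    linear_combination (norm := module) hq

lemma opDm_opDp (h : IsRep ρ) (d : ScalarData ρ n e v) :
    opDm ρ (opDp ρ v) = opDp ρ (opDm ρ v) + (4 * n * (6 * n - 3 - 4 * e)) • v := by
  have h0 : ρ NMinus (ρ P0Minus v) = ρ P1Minus v := by
    have := h.comm_P0Minus.2.2.2 v
    rw [d.annNMinus, map_zero] at this
    exact sub_eq_zero.mp this.symm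
  have h1 : ρ NMinus (ρ P1Minus v) = (2 : ℂ) • ρ XMinus v := by
    have := h.comm_P1Minus.2.2.2 v
    rw [d.annNMinus, map_zero] at this
    exact sub_eq_zero.mp this.symm
  have h2 : ρ NMinus (ρ XMinus v) = 0 := by
    rw [← h.comm_XMinus.2.2.2, d.annNMinus, map_zero]
  simp only [opDp_eq, opDm_eq, map_sub, map_add, map_smul, h.comm_plus, h.comm_NMinus, h.comm_NPlus, h.comm_ZM, h.comm_ZM', h.comm_P0Minus, h.comm_P1Minus,
      h.comm_XMinus, h.comm_minus,
    h.comm_NPlus_minus, h.comm_ZM_minus, h.comm_ZM'_minus, d.wtZ, d.wtZ', d.annNPlus,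
    d.annNMinus, h0, h1, h2, map_zero]
  linear_combination (norm := module) (-16 * n) • d.quad

end ScalarData

lemma ScalarData.exists_opDm_pow_opDp_pow {ρ : M4C →ₗ[ℂ] Module.End ℂ V} (h : IsRep ρ)
    {n e s : ℂ} {v : V} (d : ScalarData ρ n e v) (h0 : opDm ρ v = 0)
    (he : 4 * e = (n - 1) ^ 2 + s - 2 * n ^ 2 + 6 * n - 5)
    (hs : ∀ j : ℕ, ((n - 1) ^ 2 - (n + 2 * j + 1) ^ 2) * (s - (n + 2 * j + 1) ^ 2) ≠ 0)
    (j : ℕ) : ∃ c : ℂ, c ≠ 0 ∧ ((opDm ρ) ^ j) (((opDp ρ) ^ j) v) = c • v := by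
  have hd (j : ℕ) : ScalarData ρ (n + 2 * j) (e + 3 * j - 2 * n * j - 2 * j ^ 2)
      (((opDp ρ) ^ j) v) := by
    induction j with
    | zero => simpa using d
    | succ j ih =>
      have := ih.opDp_apply h
      rw [pow_succ' (opDp ρ), Module.End.mul_apply]
      convert this using 1 <;> push_cast <;> ring
  have hD (j : ℕ) : opDm ρ (((opDp ρ) ^ (j + 1)) v) =
      (((n - 1) ^ 2 - (n + 2 * j + 1) ^ 2) * (s - (n + 2 * j + 1) ^ 2)) •
        ((opDp ρ) ^ j) v := by
    have hs' : s = 4 * e - ((n - 1) ^ 2 - 2 * n ^ 2 + 6 * n - 5) := by rw [he]; ring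
    induction j with
    | zero =>
      have := d.opDm_opDp h
      rw [h0, map_zero, zero_add] at this
      rw [zero_add, pow_one, this, pow_zero, Module.End.one_apply, hs']
      congr 1
      push_cast
      ring
    | succ j ih =>
      rw [pow_succ', Module.End.mul_apply, (hd (j + 1)).opDm_opDp h, ih, map_smul,
        ← Module.End.mul_apply, ← pow_succ', ← add_smul, hs']
      congr 1
      push_cast
      ring
  induction j with
  | zero => exact ⟨1, one_ne_zero, by simp⟩
  | succ j ih =>
    obtain ⟨c, hc, hcv⟩ := ih
    exact ⟨_, mul_ne_zero (hs j) hc, by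
      rw [pow_succ, Module.End.mul_apply, hD, map_smul, hcv, smul_smul]⟩

/-- A highest weight vector of weight `0` for the `sl₂`-triple of `N₊`, `N₋` is annihilated by
`N₋` as soon as it is annihilated by some power of `N₋`. -/
lemma IsRep.NMinus_eq_zero {ρ : M4C →ₗ[ℂ] Module.End ℂ V} (h : IsRep ρ) {n : ℂ} {v : V}
    (hZ : ρ ZM v = n • v) (hZ' : ρ ZM' v = n • v) (hN : ρ NPlus v = 0)
    {k : ℕ} (hk : ((ρ NMinus) ^ k) v = 0) : ρ NMinus v = 0 := by
  have hw (j : ℕ) : ρ ZM (((ρ NMinus) ^ j) v) = (n - j) • ((ρ NMinus) ^ j) v ∧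
      ρ ZM' (((ρ NMinus) ^ j) v) = (n + j) • ((ρ NMinus) ^ j) v := by
    induction j with
    | zero => simp [hZ, hZ']
    | succ j ih =>
      rw [pow_succ', Module.End.mul_apply, h.comm_ZM.2.2.2, h.comm_ZM'.2.2.2, ih.1, ih.2,
        map_smul, map_smul]
      push_cast
      constructor <;> module
  have hp (j : ℕ) : ρ NPlus (((ρ NMinus) ^ (j + 1)) v) =
      (((j + 1 : ℕ) : ℂ) * j) • ((ρ NMinus) ^ j) v := by
    induction j with
    | zero => simp [h.comm_NPlus.2.2.2, hN, hZ, hZ']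
    | succ j ih =>
      rw [pow_succ', Module.End.mul_apply, h.comm_NPlus.2.2.2, ih, map_smul,
        ← Module.End.mul_apply, ← pow_succ', (hw (j + 1)).1, (hw (j + 1)).2]
      push_cast
      module
  induction k with
  | zero => simp_all
  | succ k ih =>
    rcases Nat.eq_zero_or_pos k with rfl | hk0
    · simpa using hk
    · refine ih ?_
      have := hp k
      rw [hk, map_zero] at this
      refine (smul_eq_zero.mp this.symm).resolve_left ?_
      exact_mod_cast (Nat.mul_pos k.succ_pos hk0).ne'

/-- The maximal generalized eigenspace for the eigenvalue `0` is stable under an operator whose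
commutator preserves it. -/
lemma mem_maxGenEigenspace_zero_of_commutator {f A B : Module.End ℂ V}
    (hAB : ∀ x, f (A x) = A (f x) + B x)
    (hB : ∀ x ∈ f.maxGenEigenspace 0, B x ∈ f.maxGenEigenspace 0) :
    ∀ x ∈ f.maxGenEigenspace 0, A x ∈ f.maxGenEigenspace 0 := by
  have hmem (x : V) : x ∈ f.maxGenEigenspace 0 ↔ ∃ k : ℕ, (f ^ k) x = 0 := by
    simp [Module.End.mem_maxGenEigenspace]
  have hlift (x : V) (hx : f x ∈ f.maxGenEigenspace 0) : x ∈ f.maxGenEigenspace 0 := by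
    obtain ⟨k, hk⟩ := (hmem _).mp hx
    exact (hmem _).mpr ⟨k + 1, by rwa [pow_succ, Module.End.mul_apply]⟩
  intro x hx
  obtain ⟨k, hk⟩ := (hmem x).mp hx
  induction k generalizing x with
  | zero =>
    rw [pow_zero, Module.End.one_apply] at hk
    simp [hk]
  | succ k ih =>
    have hfx : (f ^ k) (f x) = 0 := by rwa [pow_succ, Module.End.mul_apply] at hk
    refine hlift _ ?_
    rw [hAB]
    exact add_mem (ih (f x) ((hmem _).mpr ⟨k, hfx⟩) hfx) (hB x hx)

lemma IsRep.exists_NMinus_pow_wseq {ρ : M4C →ₗ[ℂ] Module.End ℂ V} (h : IsRep ρ) {w : V} {k : ℕ}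
    (hk : ((ρ NMinus) ^ k) w = 0) (m i : ℕ) : ∃ k : ℕ, ((ρ NMinus) ^ k) (wseq ρ w m i) = 0 := by
  have hmem (x : V) : x ∈ (ρ NMinus).maxGenEigenspace 0 ↔ ∃ k : ℕ, ((ρ NMinus) ^ k) x = 0 := by
    simp [Module.End.mem_maxGenEigenspace]
  have hN : ∀ x ∈ (ρ NMinus).maxGenEigenspace 0, ρ NMinus x ∈ (ρ NMinus).maxGenEigenspace 0 :=
    mem_maxGenEigenspace_zero_of_commutator (B := 0) (by simp) (by simp)
  have h0 : ∀ x ∈ (ρ NMinus).maxGenEigenspace 0, ρ P0Plus x ∈ (ρ NMinus).maxGenEigenspace 0 :=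
    mem_maxGenEigenspace_zero_of_commutator (B := 0) (by simp [h.comm_NMinus]) (by simp)
  have h1 : ∀ x ∈ (ρ NMinus).maxGenEigenspace 0, ρ P1Plus x ∈ (ρ NMinus).maxGenEigenspace 0 :=
    mem_maxGenEigenspace_zero_of_commutator (B := (-2 : ℂ) • ρ P0Plus)
      (by simp [h.comm_NMinus, sub_eq_add_neg])
      fun x hx ↦ Submodule.smul_mem _ _ (h0 x hx)
  have hX : ∀ x ∈ (ρ NMinus).maxGenEigenspace 0, ρ XPlus x ∈ (ρ NMinus).maxGenEigenspace 0 :=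
    mem_maxGenEigenspace_zero_of_commutator (B := -ρ P1Plus)
      (by simp [h.comm_NMinus, sub_eq_add_neg])
      fun x hx ↦ Submodule.neg_mem _ (h1 x hx)
  rw [← hmem]
  induction i with
  | zero => exact (hmem _).mpr ⟨k, hk⟩
  | succ i ih =>
    simp only [wseq, opU, pow_two, LinearMap.add_apply, LinearMap.smul_apply,
      Module.End.mul_apply]
    exact add_mem (add_mem (Submodule.smul_mem _ _ (h0 _ ih))
      (Submodule.smul_mem _ _ (h1 _ (hN _ ih)))) (hX _ (hN _ (hN _ ih)))

/-- A vector of the same weight as the canonical generator of a parabolic Verma module is a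
multiple of it. -/
lemma IsVerma.exists_eq_smul {ρ : M4C →ₗ[ℂ] Module.End ℂ V} {k l : ℤ} {g w : V}
    (h : IsVerma k l ρ g) (hZ : ρ ZM w = (k : ℂ) • w) (hZ' : ρ ZM' w = (l : ℂ) • w) :
    ∃ c : ℂ, w = c • g := by
  have hpow {A B : Module.End ℂ V} {s : ℂ} (hAB : ∀ x, B (A x) = A (B x) + s • A x) (n : ℕ)
      {x : V} {a : ℂ} (hx : B x = a • x) : B ((A ^ n) x) = (a + n * s) • (A ^ n) x := by
    induction n with
    | zero => simpa using hx
    | succ n ih =>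
      rw [pow_succ', Module.End.mul_apply, hAB, ih, map_smul]
      push_cast
      module
  let B : Module.End ℂ V := ρ ZM + (2 : ℂ) • ρ ZM'
  have hB (x : V) : B x = ρ ZM x + (2 : ℂ) • ρ ZM' x := rfl
  let b := Module.Basis.mk h.indep (fun v _ ↦ h.spans v)
  have hb (t) : b t = pbwVec ρ g t.1 := by simp [b]
  let μ : ℕ × ℕ × ℕ × ℕ → ℕ := fun t ↦ 2 * t.1 + 3 * t.2.1 + 4 * t.2.2.1 + t.2.2.2
  have hBb (t : ℕ × ℕ × ℕ × ℕ) :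
      B (pbwVec ρ g t) = ((k : ℂ) + 2 * l + μ t) • pbwVec ρ g t := by
    have hg : B g = ((k : ℂ) + 2 * l) • g := by
      rw [hB, h.wtZ, h.wtZ']
      module
    have hN := hpow (A := ρ NMinus) (B := B) (s := 1) (fun x ↦ by
      simp only [hB, h.rep.comm_ZM, h.rep.comm_ZM', map_add, map_smul]; module) t.2.2.2 hg
    have h0 := hpow (A := ρ P0Plus) (B := B) (s := 4) (fun x ↦ by
      simp only [hB, h.rep.comm_ZM, h.rep.comm_ZM', map_add, map_smul]; module) t.2.2.1 hN
    have h1 := hpow (A := ρ P1Plus) (B := B) (s := 3) (fun x ↦ by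
      simp only [hB, h.rep.comm_ZM, h.rep.comm_ZM', map_add, map_smul]; module) t.2.1 h0
    have hX := hpow (A := ρ XPlus) (B := B) (s := 2) (fun x ↦ by
      simp only [hB, h.rep.comm_ZM, h.rep.comm_ZM', map_add, map_smul]; module) t.1 h1
    simp only [pbwVec, Module.End.mul_apply]
    rw [hX]
    congr 1
    simp only [μ]
    push_cast
    ring
  have hcoord (t) : b.coord t ∘ₗ B = ((k : ℂ) + 2 * l + μ t.1) • b.coord t := by
    refine b.ext fun s ↦ ?_
    simp only [LinearMap.comp_apply, LinearMap.smul_apply, hb, hBb, map_smul]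
    rw [← hb, b.coord_apply, b.repr_self, smul_eq_mul, smul_eq_mul]
    rcases eq_or_ne s t with rfl | hst
    · rfl
    · simp [hst]
  have hw : B w = ((k : ℂ) + 2 * l) • w := by
    rw [hB, hZ, hZ']
    module
  let o : {t : ℕ × ℕ × ℕ × ℕ // (t.2.2.2 : ℤ) ≤ k - l} := ⟨(0, 0, 0, 0), by simpa using h.le⟩
  have ho : b o = g := by simp [hb, o, pbwVec]
  refine ⟨b.repr w o, b.ext_elem fun t ↦ ?_⟩
  rw [← ho, map_smul, Finsupp.smul_apply, b.repr_self, smul_eq_mul]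
  rcases eq_or_ne o t with rfl | hot
  · simp
  · rw [Finsupp.single_eq_of_ne' hot, mul_zero]
    have := LinearMap.congr_fun (hcoord t) w
    rw [LinearMap.comp_apply, hw, map_smul, LinearMap.smul_apply, ← sub_eq_zero, ← sub_smul,
      smul_eq_zero] at this
    refine this.resolve_left fun h0 ↦ hot ?_
    have hμ : μ t.1 = 0 := by
      have : (μ t.1 : ℂ) = 0 := by linear_combination -h0
      exact_mod_cast this
    obtain ⟨⟨t1, t2, t3, t4⟩, ht⟩ := t
    simp only [μ] at hμ
    simp only [o, Subtype.mk.injEq, Prod.mk.injEq]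
    omega

lemma LowerData.scalarData {ρ : M4C →ₗ[ℂ] Module.End ℂ V} {b t : ℂ} {v y : V}
    (d : LowerData ρ 0 b t v y) (hN : ρ NMinus v = 0) : ScalarData ρ b t v where
  wtZ := by simpa using d.wtZ
  wtZ' := d.wtZ'
  annNPlus := d.annNPlus
  annNMinus := hN
  quad := by
    rw [d.smul_eq, d.p0Minus, d.p1Minus, d.xMinus]
    simp only [opU, pow_two, LinearMap.add_apply, LinearMap.smul_apply, Module.End.mul_apply,
      map_smul]
    push_cast
    module

/-- The action of `𝔭₋` on the vectors `Uⁱ w`. -/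
lemma IsRep.lowerData_wseq {ρ : M4C →ₗ[ℂ] Module.End ℂ V} (h : IsRep ρ) {l : ℤ} {m : ℕ} {w : V}
    (d : LowerData ρ m l 0 w w) (i : ℕ) :
    LowerData ρ ((m : ℤ) - 2 * i) (l + 2 * i) (-(i * (l + i - 2))) (wseq ρ w m i)
      (wseq ρ w m (i - 1)) := by
  induction i with
  | zero => simpa [wseq] using d
  | succ i ih =>
    have := ih.opU_apply h
    rw [Nat.add_sub_cancel]
    change LowerData ρ _ _ _ (opU ρ ((m : ℤ) - 2 * i) (wseq ρ w m i)) _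
    convert this using 1 <;> push_cast <;> ring

/-- Let `λ = (ℓ+m, ℓ)` with `m ≥ 0` even, `ℓ ≥ 1`, and `m = 0` if `ℓ = 1`. For any
non-zero `w₀ ∈ N(λ)` of weight `(ℓ+m, ℓ)` with `N₊ w₀ = 0` and any `β ≥ 0`, the vector
`P₀₋^{m/2} D₋^β D₊^β U^{m/2} w₀` is a non-zero scalar multiple of `w₀`. -/
theorem statement18 (l : ℤ) (m : ℕ) (hm : Even m) (hl : 1 ≤ l) (hl1 : l = 1 → m = 0)
    (V : Type) [AddCommGroup V] [Module ℂ V]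
    (ρ : M4C →ₗ[ℂ] Module.End ℂ V) (wgen : V) (h : IsVerma (l + m) l ρ wgen)
    (w : V) (hw : w ≠ 0) (hwZ : ρ ZM w = ((l + m : ℤ) : ℂ) • w)
    (hwZ' : ρ ZM' w = (l : ℂ) • w) (hwN : ρ NPlus w = 0)
    (β : ℕ) :
    ∃ c : ℂ, c ≠ 0 ∧
      ((ρ P0Minus) ^ (m / 2)) (((opDm ρ) ^ β) (((opDp ρ) ^ β) (wseq ρ w m (m / 2))))
        = c • w := by
  obtain ⟨k, hk⟩ := hm.two_dvd
  have hrep := h.rep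
  obtain ⟨c, rfl⟩ := h.exists_eq_smul hwZ hwZ'
  have d : LowerData ρ m l 0 (c • wgen) (c • wgen) :=
    ⟨by rw [hwZ]; push_cast; rfl, hwZ', hwN, by simp [h.annP0Minus], by simp [h.annP1Minus],
      by simp [h.annXMinus], by simp, by simp [opDm_eq, h.annP0Minus, h.annP1Minus]⟩
  have hnil : ((ρ NMinus) ^ ((l + m - l : ℤ).toNat + 1)) (c • wgen) = 0 := by
    rw [map_smul, h.annNMinusPow, smul_zero]
  generalize c • wgen = w at *
  have hL := hrep.lowerData_wseq d
  have hdiv : m / 2 = k := by omega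
  rw [hdiv]
  have du := hL k
  rw [show (m : ℤ) - 2 * k = 0 by omega] at du
  obtain ⟨q, hq⟩ := hrep.exists_NMinus_pow_wseq hnil m k
  have hNu := hrep.NMinus_eq_zero (by simpa using du.wtZ) du.wtZ' du.annNPlus hq
  obtain ⟨c₁, hc₁, h₁⟩ := (du.scalarData hNu).exists_opDm_pow_opDp_pow hrep du.dMinus
    (s := (l - 2) ^ 2) (by ring) (fun j ↦ by
      have hz : ((l + 2 * k - 1) ^ 2 - (l + 2 * k + 2 * j + 1) ^ 2) *
          ((l - 2) ^ 2 - (l + 2 * k + 2 * j + 1) ^ 2) ≠ 0 := by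
        rw [sq_sub_sq, sq_sub_sq]
        refine mul_ne_zero (mul_ne_zero ?_ ?_) (mul_ne_zero ?_ ?_) <;> omega
      exact_mod_cast hz) β
  have hP (i : ℕ) (hi : i ≤ k) :
      ∃ c : ℂ, c ≠ 0 ∧ ((ρ P0Minus) ^ i) (wseq ρ w m i) = c • w := by
    induction i with
    | zero => exact ⟨1, one_ne_zero, by simp [wseq]⟩
    | succ i ih =>
      obtain ⟨c, hc, hcw⟩ := ih (by omega)
      have h0 := (hL (i + 1)).p0Minus
      rw [Nat.add_sub_cancel] at h0
      refine ⟨_, mul_ne_zero ?_ hc, by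
        rw [pow_succ, Module.End.mul_apply, h0, map_smul, hcw, smul_smul]⟩
      have hz : ((m : ℤ) - 2 * (i + 1) + 2) * ((m : ℤ) - 2 * (i + 1) + 1) *
          (-((i + 1) * (l + (i + 1) - 2))) ≠ 0 := by
        refine mul_ne_zero (mul_ne_zero ?_ ?_) (neg_ne_zero.mpr (mul_ne_zero ?_ ?_)) <;> omega
      exact_mod_cast hz
  obtain ⟨c₂, hc₂, h₂⟩ := hP k le_rfl
  exact ⟨c₁ * c₂, mul_ne_zero hc₁ hc₂, by rw [h₁, map_smul, h₂, smul_smul]⟩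

end
end
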